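/- arXiv:2505.12156 — 2 statements merged into one kernel-verified Lean document; each statement's English description precedes it below -/
import Mathlib

section
/- Let G be a finite undirected graph with vertex set K, without loops or multiple edges, such that the K×K matrix 2·Id − Adj(G) is positive definite (i.e. G is a possibly disconnected finite-type ADE Dynkin diagram). Then the preprojective algebra Π of G is finite-dimensional as a ℂ-vector space. -/
noncomputable section

open scoped BigOperators

namespace Stmt2

variable {K : Type} [Fintype K] [DecidableEq K]

/-- Arrows of the double quiver of a simple graph: an arrow `⟨(i,j), h⟩` goes from `i` to `j`. -/
def Arrow (G : SimpleGraph K) : Type := {p : K × K // G.Adj p.1 p.2}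

/-- Source of an arrow. -/
abbrev src {G : SimpleGraph K} (a : Arrow G) : K := a.1.1

/-- Target of an arrow. -/
abbrev tgt {G : SimpleGraph K} (a : Arrow G) : K := a.1.2

/-- The reverse arrow `a*`. -/
def star {G : SimpleGraph K} (a : Arrow G) : Arrow G := ⟨(a.1.2, a.1.1), a.2.symm⟩

/-- Generators of the free algebra: vertex idempotents and arrows of the double quiver. -/
def Gen (G : SimpleGraph K) : Type := K ⊕ Arrow G

/-- The free `ℂ`-algebra on the generators. -/
abbrev F (G : SimpleGraph K) : Type := FreeAlgebra ℂ (Gen G)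

/-- The generator `e_i`. -/
def eIdem (G : SimpleGraph K) (i : K) : F G := FreeAlgebra.ι ℂ (Sum.inl i)

/-- The generator corresponding to an arrow. -/
def arr (G : SimpleGraph K) (a : Arrow G) : F G := FreeAlgebra.ι ℂ (Sum.inr a)

/-- The defining relations of the preprojective algebra. -/
def Rels (G : SimpleGraph K) [DecidableRel G.Adj] (ε : Arrow G → ℂ) : Set (F G) :=
  {x | (∃ i j : K, x = eIdem G i * eIdem G j - if i = j then eIdem G i else 0) ∨
       (x = 1 - ∑ i : K, eIdem G i) ∨
       (∃ a : Arrow G, x = eIdem G (tgt a) * arr G a - arr G a) ∨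
       (∃ a : Arrow G, x = arr G a * eIdem G (src a) - arr G a) ∨
       (∃ i : K, x = ∑ j : K,
          if h : G.Adj j i then
            ε ⟨(j, i), h⟩ • (arr G ⟨(j, i), h⟩ * arr G ⟨(i, j), h.symm⟩)
          else 0)}

/-- The relation whose `RingQuot` is the quotient by the two-sided ideal
generated by `Rels G ε`. -/
def relR (G : SimpleGraph K) [DecidableRel G.Adj] (ε : Arrow G → ℂ) :
    F G → F G → Prop :=
  fun x y => x ∈ Rels G ε ∧ y = 0

/-- The preprojective algebra of `G`. -/
abbrev Preproj (G : SimpleGraph K) [DecidableRel G.Adj] (ε : Arrow G → ℂ) : Type :=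
  RingQuot (relR G ε)

/-- A positive definite form bounds each coordinate. -/
lemma coord_bound (C : Matrix K K ℝ) (hC : C.PosDef) (i : K) :
    ∃ M : ℝ, 0 ≤ M ∧ ∀ v : K → ℝ, (v i) ^ 2 ≤ M * (v ⬝ᵥ C.mulVec v) := by
  have hu : IsUnit C.det := (Matrix.isUnit_iff_isUnit_det C).1 hC.isUnit
  have hsymm : C.transpose = C := by
    have := hC.isHermitian
    simpa [Matrix.IsHermitian, Matrix.conjTranspose_eq_transpose_of_trivial] using this
  have hpos : 0 < C⁻¹ i i := hC.inv.diag_pos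
  refine ⟨C⁻¹ i i, hpos.le, fun v => ?_⟩
  set w : K → ℝ := C⁻¹.mulVec (Pi.single i 1) with hw
  have hCw : C.mulVec w = Pi.single i 1 := by
    rw [hw, Matrix.mulVec_mulVec, Matrix.mul_nonsing_inv _ hu, Matrix.one_mulVec]
  have hwi : w i = C⁻¹ i i := by simp [hw]
  have hwv : w ⬝ᵥ C.mulVec v = v i := by
    rw [Matrix.dotProduct_mulVec, ← Matrix.mulVec_transpose, hsymm, hCw]; simp
  have hvw : v ⬝ᵥ C.mulVec w = v i := by rw [hCw]; simp
  have hww : w ⬝ᵥ C.mulVec w = C⁻¹ i i := by rw [hCw]; simp [hwi]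
  set c := C⁻¹ i i
  have h0 : 0 ≤ (v - (v i / c) • w) ⬝ᵥ C.mulVec (v - (v i / c) • w) := by
    have := hC.posSemidef.dotProduct_mulVec_nonneg (v - (v i / c) • w)
    simpa using this
  rw [Matrix.mulVec_sub, Matrix.mulVec_smul, sub_dotProduct, dotProduct_sub, dotProduct_sub,
    smul_dotProduct, smul_dotProduct, dotProduct_smul, dotProduct_smul, hwv, hvw, hww] at h0
  simp only [smul_eq_mul] at h0
  have : c * (v ⬝ᵥ C.mulVec v) - (v i)^2 = c * (v ⬝ᵥ C.mulVec v - v i / c * v i - (v i / c * v i - v i / c * (v i / c * c))) := by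
    field_simp; ring
  nlinarith [mul_nonneg hpos.le h0]

lemma cartan_mulVec (G : SimpleGraph K) [DecidableRel G.Adj] (v : K → ℝ) (i : K) :
    ((2 : ℝ) • (1 : Matrix K K ℝ) - G.adjMatrix ℝ).mulVec v i =
      2 * v i - ∑ j, if G.Adj i j then v j else 0 := by
  rw [Matrix.sub_mulVec, Matrix.smul_mulVec, Matrix.one_mulVec]
  simp [Matrix.mulVec, dotProduct, SimpleGraph.adjMatrix_apply]

lemma refl_form (G : SimpleGraph K) [DecidableRel G.Adj] (v v' : K → ℝ) (i : K)
    (h1 : v' i + v i = ∑ j, if G.Adj i j then v j else 0)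
    (h2 : ∀ j, j ≠ i → v' j = v j) :
    v' ⬝ᵥ ((2 : ℝ) • (1 : Matrix K K ℝ) - G.adjMatrix ℝ).mulVec v' =
    v ⬝ᵥ ((2 : ℝ) • (1 : Matrix K K ℝ) - G.adjMatrix ℝ).mulVec v := by
  set C := (2 : ℝ) • (1 : Matrix K K ℝ) - G.adjMatrix ℝ with hC
  have hsymm : C.transpose = C := by
    rw [hC, Matrix.transpose_sub, Matrix.transpose_smul, Matrix.transpose_one,
      SimpleGraph.transpose_adjMatrix]
  set c := C.mulVec v i with hc
  have hc' : c = 2 * v i - ∑ j, if G.Adj i j then v j else 0 := cartan_mulVec G v i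
  have hv' : v' = v - c • Pi.single i 1 := by
    funext j
    by_cases hj : j = i
    · subst hj; simp; linarith
    · simp [hj, h2 j hj]
  have e1 : (Pi.single i 1 : K → ℝ) ⬝ᵥ C.mulVec v = c := by simp [hc]
  have e2 : v ⬝ᵥ C.mulVec (Pi.single i 1) = c := by
    rw [Matrix.dotProduct_mulVec, ← Matrix.mulVec_transpose, hsymm]; simp [hc]
  have e3 : (Pi.single i 1 : K → ℝ) ⬝ᵥ C.mulVec (Pi.single i 1) = 2 := by
    simp [hC]
  rw [hv', Matrix.mulVec_sub, Matrix.mulVec_smul, sub_dotProduct, dotProduct_sub, dotProduct_sub,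
    smul_dotProduct, smul_dotProduct, dotProduct_smul, dotProduct_smul, e1, e2, e3]
  simp only [smul_eq_mul]; ring

lemma term_lemma (G : SimpleGraph K) [DecidableRel G.Adj]
    (hG : ((2 : ℝ) • (1 : Matrix K K ℝ) - G.adjMatrix ℝ).PosDef)
    (n : ℕ) (hn : 0 < n) (e : K ≃ Fin n) (d : ℕ → K → ℕ) (t0 : ℕ) (h0 : d t0 ≠ 0)
    (h1 : ∀ t, t0 ≤ t → ∀ i, (e i : ℕ) = t % n →
      d (t+1) i + d t i = ∑ j, if G.Adj i j then d t j else 0)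
    (h2 : ∀ t, t0 ≤ t → ∀ i, (e i : ℕ) ≠ t % n → d (t+1) i = d t i) : False := by
  set C := (2 : ℝ) • (1 : Matrix K K ℝ) - G.adjMatrix ℝ with hC
  let v : ℕ → K → ℝ := fun t i => (d t i : ℝ)
  have hv1 : ∀ t, t0 ≤ t → ∀ i, (e i : ℕ) = t % n →
      v (t+1) i + v t i = ∑ j, if G.Adj i j then v t j else 0 := by
    intro t ht i hi
    have := h1 t ht i hi
    simp only [v]
    exact_mod_cast this
  have hv2 : ∀ t, t0 ≤ t → ∀ i, (e i : ℕ) ≠ t % n → v (t+1) i = v t i := by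
    intro t ht i hi
    simp only [v, h2 t ht i hi]
  have hidx : ∀ t, ∃ i, (e i : ℕ) = t % n := fun t =>
    ⟨e.symm ⟨t % n, Nat.mod_lt _ hn⟩, by simp⟩
  -- invariance of the form
  have hq : ∀ t, t0 ≤ t → v t ⬝ᵥ C.mulVec (v t) = v t0 ⬝ᵥ C.mulVec (v t0) := by
    intro t ht
    induction t, ht using Nat.le_induction with
    | base => rfl
    | succ t ht ih =>
      rw [← ih]
      obtain ⟨i, hi⟩ := hidx t
      refine refl_form G (v t) (v (t+1)) i (hv1 t ht i hi) fun j hj => hv2 t ht j ?_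
      intro h
      exact hj (e.injective (Fin.ext (h.trans hi.symm)))
  have hpos : 0 < v t0 ⬝ᵥ C.mulVec (v t0) := by
    have hne : v t0 ≠ 0 := by
      intro h
      apply h0
      funext i
      have := congrFun h i
      simpa [v] using this
    simpa using hG.dotProduct_mulVec_pos hne
  set q0 := v t0 ⬝ᵥ C.mulVec (v t0) with hq0
  -- finiteness
  choose M hM0 hM using coord_bound C hG
  have hfin : ∀ t, t0 ≤ t → d t ∈ Set.pi Set.univ (fun i => Set.Iic ⌊M i * q0⌋₊) := by
    intro t ht i _
    have h := hM i (v t)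
    rw [hq t ht] at h
    refine Nat.le_floor ?_
    have h' : ((d t i : ℕ) : ℝ) ≤ (d t i : ℝ) ^ 2 := by
      exact_mod_cast Nat.le_self_pow two_ne_zero _
    exact h'.trans h
  have hF : (Set.pi Set.univ (fun i : K => Set.Iic ⌊M i * q0⌋₊)).Finite :=
    Set.Finite.pi' (fun i => Set.finite_Iic _) |>.subset (by intro x hx i; exact hx i trivial)
  have hge : ∀ k, t0 ≤ n * (t0 + k) := fun k => by nlinarith
  obtain ⟨k, l, hkl, hdkl⟩ : ∃ k l, k < l ∧ d (n * (t0 + k)) = d (n * (t0 + l)) := by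
    obtain ⟨k, -, l, -, hkl, h⟩ := Set.infinite_univ.exists_ne_map_eq_of_mapsTo
      (f := fun k => d (n * (t0 + k))) (fun k _ => hfin _ (hge k)) hF
    rcases lt_or_gt_of_ne hkl with h' | h'
    · exact ⟨k, l, h', h⟩
    · exact ⟨l, k, h', h.symm⟩
  let D : ℕ → K → ℝ := fun r i => ∑ m ∈ Finset.Ico k l, v (n * (t0 + m) + r) i
  have hD1 : ∀ r, r < n → ∀ i, (e i : ℕ) = r →
      D (r+1) i + D r i = ∑ j, if G.Adj i j then D r j else 0 := by
    intro r hr i hi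
    have : ∀ m, v (n * (t0 + m) + (r + 1)) i + v (n * (t0 + m) + r) i =
        ∑ j, if G.Adj i j then v (n * (t0 + m) + r) j else 0 := fun m =>
      hv1 _ ((hge m).trans (Nat.le_add_right _ _)) i
        (by rw [Nat.mul_add_mod, Nat.mod_eq_of_lt hr, hi])
    simp only [D]
    rw [← Finset.sum_add_distrib, Finset.sum_congr rfl (fun m _ => this m), Finset.sum_comm]
    refine Finset.sum_congr rfl fun j _ => ?_
    split_ifs <;> simp
  have hD2 : ∀ r, r < n → ∀ i, (e i : ℕ) ≠ r → D (r+1) i = D r i := by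
    intro r hr i hi
    refine Finset.sum_congr rfl fun m _ => ?_
    exact hv2 _ ((hge m).trans (Nat.le_add_right _ _)) i
        (by rw [Nat.mul_add_mod, Nat.mod_eq_of_lt hr]; exact hi)
  have hDn : D n = D 0 := by
    funext i
    have e1 : D n i = ∑ m ∈ Finset.Ico k l, v (n * (t0 + (m + 1))) i :=
      Finset.sum_congr rfl fun m _ => by congr 1
    have e2 := Finset.sum_Ico_sub (f := fun m => v (n * (t0 + m)) i) hkl.le
    have e3 : D 0 i = ∑ m ∈ Finset.Ico k l, v (n * (t0 + m)) i := rfl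
    rw [Finset.sum_sub_distrib, ← e1, ← e3] at e2
    have e4 : v (n * (t0 + l)) i = v (n * (t0 + k)) i := by simp only [v, hdkl]
    linarith
  have hlow : ∀ r, r ≤ n → ∀ i, r ≤ (e i : ℕ) → D r i = D 0 i := by
    intro r
    induction r with
    | zero => intros; rfl
    | succ r ih =>
      intro hr i hi
      rw [hD2 r (by omega) i (by omega), ih (by omega) i (by omega)]
  have hhigh : ∀ s r, r + s = n → ∀ i, (e i : ℕ) < r → D r i = D n i := by
    intro s
    induction s with
    | zero => intro r hr i _; simp at hr; rw [hr]
    | succ s ih =>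
      intro r hr i hi
      rw [← hD2 r (by omega) i (by omega), ih (r+1) (by omega) i (by omega)]
  have hconst : ∀ r, r ≤ n → D r = D 0 := by
    intro r hr
    funext i
    by_cases h : r ≤ (e i : ℕ)
    · exact hlow r hr i h
    · rw [hhigh (n - r) r (by omega) i (by omega), hDn]
  have hCD : C.mulVec (D 0) = 0 := by
    funext i
    have hi := (e i).2
    have := hD1 (e i) hi i rfl
    rw [hconst _ hi.le, hconst _ (Nat.succ_le_of_lt hi)] at this
    rw [hC, cartan_mulVec]
    simp only [Pi.zero_apply]; linarith
  have hD0 : D 0 = 0 := by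
    by_contra hne
    have := hG.dotProduct_mulVec_pos hne
    rw [hCD] at this
    simp at this
  have hvk : v (n * (t0 + k)) = 0 := by
    funext i
    have h := congrFun hD0 i
    have h' := (Finset.sum_eq_zero_iff_of_nonneg (s := Finset.Ico k l)
      (f := fun m => v (n * (t0 + m) + 0) i) (fun m _ => Nat.cast_nonneg _)).1 h k
      (Finset.mem_Ico.2 ⟨le_rfl, hkl⟩)
    exact h'
  have := hq _ (hge k)
  rw [hvk] at this
  simp at this
  linarith

/-- The relations of the preprojective algebra, with arrows indexed by all pairs. -/
structure PPData (G : SimpleGraph K) {A : Type} [Ring A] [Algebra ℂ A]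
    (e : K → A) (b : K → K → A) (ε : K → K → ℂ) : Prop where
  ee : ∀ i j, e i * e j = if i = j then e i else 0
  bz : ∀ i j, ¬ G.Adj i j → b i j = 0
  eb : ∀ i j, e j * b i j = b i j
  be : ∀ i j, b i j * e i = b i j
  rel : ∀ i, ∑ j, ε j i • (b j i * b i j) = 0
  ne : ∀ i j, G.Adj i j → ε i j ≠ 0

/-- The ambient space in which all vertex spaces live. -/
abbrev U : Type := ℕ →₀ ℂ

/-- There is a finite dimensional subspace containing `e s`, stable under the generators. -/
def Done {A : Type} [Ring A] [Algebra ℂ A] (e : K → A) (b : K → K → A) (s : K) : Prop :=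
  ∃ P : Submodule ℂ A, FiniteDimensional ℂ P ∧ e s ∈ P ∧ (∀ i, ∀ p ∈ P, e i * p ∈ P) ∧
    (∀ i j, ∀ p ∈ P, b i j * p ∈ P)

/-- A slice representation: a brick for the orientation given by the stamps `κ`, mapping to `A`. -/
structure Slice (G : SimpleGraph K) {A : Type} [Ring A] [Algebra ℂ A]
    (e : K → A) (b : K → K → A) (s : K) (κ : K → ℕ) (X : K → Submodule ℂ U)
    (f : K → K → U →ₗ[ℂ] U) (φ : K → U →ₗ[ℂ] A) (P : Submodule ℂ A) : Prop where
  fd : ∀ i, FiniteDimensional ℂ (X i)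
  fX : ∀ i j, G.Adj i j → κ i < κ j → ∀ x ∈ X i, f i j x ∈ X j
  φf : ∀ i j, G.Adj i j → κ i < κ j → ∀ x ∈ X i, φ j (f i j x) = b i j * φ i x
  φe : ∀ i, ∀ x ∈ X i, e i * φ i x = φ i x
  φP : ∀ i, ∀ x ∈ X i, φ i x ∈ P
  Pfd : FiniteDimensional ℂ P
  es : e s ∈ P
  eP : ∀ i, ∀ p ∈ P, e i * p ∈ P
  bP : ∀ i j, ∀ p ∈ P, ∃ p' ∈ P, ∃ x ∈ X i, b i j * p = p' + b i j * φ i x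
  brick : ∀ h : K → U →ₗ[ℂ] U, (∀ i, ∀ x ∈ X i, h i x ∈ X i) →
    (∀ i j, G.Adj i j → κ i < κ j → ∀ x ∈ X i, h j (f i j x) = f i j (h i x)) →
    ∃ c : ℂ, ∀ i, ∀ x ∈ X i, h i x = c • x

def Good (G : SimpleGraph K) {A : Type} [Ring A] [Algebra ℂ A]
    (e : K → A) (b : K → K → A) (s : K) (κ : K → ℕ) (d : K → ℕ) : Prop :=
  ∃ X f φ P, Slice G e b s κ X f φ P ∧ ∀ i, Module.finrank ℂ (X i) = d i

lemma exists_ker_eq (R : Submodule ℂ (K → U)) : ∃ g : (K → U) →ₗ[ℂ] U, LinearMap.ker g = R := by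
  have h : Module.rank ℂ ((K → U) ⧸ R) ≤ Module.rank ℂ U := by
    refine (rank_quotient_le R).trans ?_
    rw [rank_fun, rank_finsupp_self']
    rw [Cardinal.mk_nat]
    exact (Cardinal.mul_le_max_of_aleph0_le_right le_rfl).trans
      (max_le (Cardinal.natCast_lt_aleph0).le le_rfl)
  obtain ⟨g, hg⟩ := (rank_le_iff_exists_linearMap (R := ℂ)).1 h
  refine ⟨g ∘ₗ R.mkQ, ?_⟩
  rw [LinearMap.ker_comp, LinearMap.ker_eq_bot.2 hg, Submodule.comap_bot, Submodule.ker_mkQ]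

lemma exists_factor {V W Z : Type} [AddCommGroup V] [Module ℂ V] [AddCommGroup W] [Module ℂ W]
    [AddCommGroup Z] [Module ℂ Z] (g : V →ₗ[ℂ] W) (Φ : V →ₗ[ℂ] Z)
    (h : ∀ v, g v = 0 → Φ v = 0) : ∃ ψ : W →ₗ[ℂ] Z, ∀ v, ψ (g v) = Φ v := by
  have hk : LinearMap.ker g ≤ LinearMap.ker Φ := fun v hv => h v hv
  obtain ⟨ψ, hψ⟩ := LinearMap.exists_extend
    ((LinearMap.ker g).liftQ Φ hk ∘ₗ g.quotKerEquivRange.symm.toLinearMap)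
  refine ⟨ψ, fun v => ?_⟩
  have := LinearMap.congr_fun hψ ⟨g v, v, rfl⟩
  simp only [LinearMap.comp_apply, Submodule.subtype_apply, LinearEquiv.coe_coe] at this
  rw [this]
  have h2 : g.quotKerEquivRange.symm ⟨g v, v, rfl⟩ = Submodule.Quotient.mk v := by
    rw [LinearEquiv.symm_apply_eq]; rfl
  rw [h2]; rfl

lemma exists_left_inv {V : Type} [AddCommGroup V] [Module ℂ V] (X : Submodule ℂ U)
    (o : U →ₗ[ℂ] V) (h : ∀ x ∈ X, o x = 0 → x = 0) : ∃ l : V →ₗ[ℂ] U, ∀ x ∈ X, l (o x) = x := by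
  obtain ⟨l, hl⟩ := exists_factor (o ∘ₗ X.subtype) X.subtype
    (fun v hv => h (Subtype.val v) (Subtype.property v) hv)
  exact ⟨l, fun x hx => hl ⟨x, hx⟩⟩

lemma finrank_piSub (X : K → Submodule ℂ U) [∀ i, FiniteDimensional ℂ (X i)] :
    FiniteDimensional ℂ (Submodule.pi Set.univ X : Submodule ℂ (K → U)) ∧
    Module.finrank ℂ (Submodule.pi Set.univ X : Submodule ℂ (K → U)) =
      ∑ i, Module.finrank ℂ (X i) := by
  let E : ((i : K) → X i) ≃ₗ[ℂ] (Submodule.pi Set.univ X : Submodule ℂ (K → U)) :=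
    { toFun := fun w => ⟨fun i => w i, fun i _ => (w i).2⟩
      invFun := fun w i => ⟨w.1 i, w.2 i trivial⟩
      map_add' := fun _ _ => rfl
      map_smul' := fun _ _ => rfl
      left_inv := fun _ => rfl
      right_inv := fun _ => rfl }
  refine ⟨Module.Finite.equiv E, ?_⟩
  have hfree : ∀ i, Module.Free ℂ (X i) := fun i => Module.Free.of_divisionRing ℂ (X i)
  rw [← E.finrank_eq, Module.finrank_pi_fintype]

lemma slice_step (G : SimpleGraph K) [DecidableRel G.Adj] {A : Type} [Ring A] [Algebra ℂ A]
    {e : K → A} {b : K → K → A} {ε : K → K → ℂ} (hA : PPData G e b ε) (s : K)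
    (κ : K → ℕ) (d : K → ℕ) (hgood : Good G e b s κ d) (i : K) (m : ℕ)
    (hmin : ∀ j, j ≠ i → κ i < κ j) (hmax : ∀ j, κ j < m) (hnd : ¬ Done e b s) :
    d i ≤ (∑ j, if G.Adj i j then d j else 0) ∧
    Good G e b s (Function.update κ i m)
      (Function.update d i ((∑ j, if G.Adj i j then d j else 0) - d i)) := by
  obtain ⟨X, f, φ, P, H, hd⟩ := hgood
  have hlt : ∀ j, G.Adj i j → κ i < κ j := fun j hj => hmin j hj.ne'
  have bzero : ∀ k l x, k ≠ i → e i * x = x → b k l * x = 0 := by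
    intro k l x hk hx
    rw [← hA.be k l, ← hx, mul_assoc, ← mul_assoc (e k), hA.ee, if_neg hk, zero_mul, mul_zero]
  have biP : ∀ l, ∀ x ∈ X i, b i l * φ i x ∈ P := by
    intro l x hx
    by_cases hl : G.Adj i l
    · rw [← H.φf i l hl (hlt l hl) x hx]
      exact H.φP l _ (H.fX i l hl (hlt l hl) x hx)
    · rw [hA.bz i l hl, zero_mul]; exact P.zero_mem
  -- the outgoing map
  let o : U →ₗ[ℂ] (K → U) := LinearMap.pi fun j => if G.Adj i j then ε j i • f i j else 0
  have ho1 : ∀ x j, G.Adj i j → o x j = ε j i • f i j x := fun x j hj => by simp [o, hj]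
  have ho2 : ∀ x j, ¬ G.Adj i j → o x j = 0 := fun x j hj => by simp [o, hj]
  -- injectivity
  have hinj : ∀ x ∈ X i, o x = 0 → x = 0 := by
    intro x0 hx0 hox
    by_contra hne
    have hf0 : ∀ j, G.Adj i j → f i j x0 = 0 := by
      intro j hj
      have h1 := ho1 x0 j hj
      rw [hox] at h1
      exact (smul_eq_zero.1 h1.symm).resolve_left (hA.ne j i hj.symm)
    obtain ⟨lam, hlam⟩ : ∃ lam : U →ₗ[ℂ] ℂ, lam x0 = 1 := by
      obtain ⟨lam, hlam⟩ := Module.Projective.exists_dual_ne_zero ℂ hne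
      exact ⟨(lam x0)⁻¹ • lam, by simp [inv_mul_cancel₀ hlam]⟩
    obtain ⟨c, hc⟩ := H.brick (fun j => if j = i then lam.smulRight x0 else 0)
      (by
        intro j x hx
        by_cases hj : j = i
        · subst hj; simp; exact (X j).smul_mem _ hx0
        · simp [hj])
      (by
        intro k l hkl hκ x hx
        by_cases hl : l = i
        · subst hl
          exact absurd hκ (not_lt.2 (hlt k hkl.symm).le)
        · by_cases hk : k = i
          · subst hk; simp [hl, hf0 l hkl]
          · simp [hl, hk])
    have hc1 : c = 1 := by
      have := hc i x0 hx0
      simp [hlam] at this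
      have h2 : ((1:ℂ) - c) • x0 = 0 := by rw [sub_smul, one_smul, ← this, sub_self]
      have := (smul_eq_zero.1 h2).resolve_right hne
      exact (sub_eq_zero.1 this).symm
    subst hc1
    apply hnd
    refine ⟨P, H.Pfd, H.es, H.eP, ?_⟩
    intro k l p hp
    obtain ⟨p', hp', x, hx, h⟩ := H.bP k l p hp
    rw [h]
    refine P.add_mem hp' ?_
    by_cases hk : k = i
    · subst hk; exact biP l x hx
    · have := hc k x hx
      simp [hk] at this
      rw [← this]; simp
  obtain ⟨l, hl⟩ := exists_left_inv (X i) o hinj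
  obtain ⟨g, hg⟩ := exists_ker_eq ((X i).map o)
  have hg0 : ∀ w, g w = 0 ↔ ∃ x ∈ X i, o x = w := by
    intro w; rw [← LinearMap.mem_ker, hg, Submodule.mem_map]
  let X0 : K → Submodule ℂ U := fun j => if G.Adj i j then X j else ⊥
  have hX01 : ∀ j, G.Adj i j → X0 j = X j := fun j hj => by simp [X0, hj]
  have hX02 : ∀ j, ¬ G.Adj i j → X0 j = ⊥ := fun j hj => by simp [X0, hj]
  have hX0fd : ∀ j, FiniteDimensional ℂ (X0 j) := by
    intro j
    by_cases hj : G.Adj i j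
    · rw [hX01 j hj]; exact H.fd j
    · rw [hX02 j hj]; infer_instance
  let N : Submodule ℂ (K → U) := Submodule.pi Set.univ X0
  obtain ⟨hNfd, hNrk⟩ := finrank_piSub X0
  have : FiniteDimensional ℂ N := hNfd
  have hoN : ∀ x ∈ X i, o x ∈ N := by
    intro x hx j _
    change o x j ∈ X0 j
    by_cases hj : G.Adj i j
    · rw [hX01 j hj, ho1 x j hj]; exact (X j).smul_mem _ (H.fX i j hj (hlt j hj) x hx)
    · rw [ho2 x j hj]; exact (X0 j).zero_mem
  let Φ : (K → U) →ₗ[ℂ] A :=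
    ∑ j, (LinearMap.mulLeft ℂ (b j i)) ∘ₗ φ j ∘ₗ (LinearMap.proj j)
  have hΦ : ∀ w, Φ w = ∑ j, b j i * φ j (w j) := by
    intro w; simp [Φ]
  obtain ⟨ψ, hψ⟩ := exists_factor g Φ (by
    intro w hw
    obtain ⟨x, hx, rfl⟩ := (hg0 w).1 hw
    rw [hΦ]
    have : ∀ j, b j i * φ j (o x j) = (ε j i • (b j i * b i j)) * φ i x := by
      intro j
      by_cases hj : G.Adj i j
      · rw [ho1 x j hj, map_smul, H.φf i j hj (hlt j hj) x hx, mul_smul_comm, smul_mul_assoc,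
          mul_assoc]
      · rw [hA.bz j i (fun h => hj h.symm)]; simp
    rw [Finset.sum_congr rfl (fun j _ => this j), ← Finset.sum_mul, hA.rel, zero_mul])
  let Y : Submodule ℂ U := N.map g
  have hYfd : FiniteDimensional ℂ Y := inferInstanceAs (FiniteDimensional ℂ (N.map g))
  have hψe : ∀ y ∈ Y, e i * ψ y = ψ y := by
    rintro _ ⟨w, _, rfl⟩
    rw [hψ, hΦ, Finset.mul_sum]
    exact Finset.sum_congr rfl fun j _ => by rw [← mul_assoc, hA.eb]
  -- dimension count
  have hrk : Module.finrank ℂ Y + d i = ∑ j, if G.Adj i j then d j else 0 := by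
    have h1 := LinearMap.finrank_range_add_finrank_ker (K := ℂ) (V := N) (V₂ := U) (g.domRestrict N)
    have h2 : LinearMap.range (g.domRestrict N) = Y := by
      rw [LinearMap.range_domRestrict]
    have h3 : Module.finrank ℂ (LinearMap.ker (g.domRestrict N)) = d i := by
      rw [← hd i]
      symm
      let T : X i →ₗ[ℂ] LinearMap.ker (g.domRestrict N) :=
        { toFun := fun x => ⟨⟨o x, hoN x x.2⟩, (hg0 _).2 ⟨x, x.2, rfl⟩⟩
          map_add' := fun x y => by ext1; ext1; simp
          map_smul' := fun c x => by ext1; ext1; simp }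
      refine (LinearEquiv.ofBijective T ⟨?_, ?_⟩).finrank_eq
      · intro x y hxy
        have : o x = o y := congrArg (fun z => (z.1.1 : K → U)) hxy
        ext1
        rw [← hl x x.2, ← hl y y.2, this]
      · rintro ⟨⟨w, hw⟩, hw'⟩
        obtain ⟨x, hx, hxw⟩ := (hg0 w).1 hw'
        exact ⟨⟨x, hx⟩, by ext1; ext1; exact hxw⟩
    rw [h2, h3, hNrk] at h1
    rw [h1]
    refine Finset.sum_congr rfl fun j _ => ?_
    by_cases hj : G.Adj i j
    · rw [hX01 j hj, if_pos hj, hd]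
    · rw [hX02 j hj, if_neg hj, finrank_bot]
  refine ⟨by omega, Function.update X i Y,
    fun a c => if c = i then g ∘ₗ LinearMap.single ℂ (fun _ : K => U) a else f a c,
    Function.update φ i ψ, P ⊔ Y.map ψ, ?_, ?_⟩
  swap
  · intro j
    by_cases hj : j = i
    · subst hj; rw [Function.update_self, Function.update_self]; omega
    · rw [Function.update_of_ne hj, Function.update_of_ne hj, hd]
  have hsingN : ∀ k, G.Adj i k → ∀ x ∈ X k, Pi.single k x ∈ N := by
    intro k hk x hx j _
    change (Pi.single k x : K → U) j ∈ X0 j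
    by_cases hj : j = k
    · subst hj; rw [hX01 j hk]; simpa using hx
    · rw [Pi.single_eq_of_ne hj]; exact (X0 j).zero_mem
  have hκ' : ∀ k c, G.Adj k c → Function.update κ i m k < Function.update κ i m c →
      k ≠ i ∧ (c ≠ i → κ k < κ c) := by
    intro k c hkc h
    by_cases hk : k = i
    · subst hk
      rw [Function.update_self, Function.update_of_ne hkc.ne'] at h
      exact absurd h (not_lt.2 (hmax c).le)
    · refine ⟨hk, fun hc => ?_⟩
      rwa [Function.update_of_ne hk, Function.update_of_ne hc] at h
  constructor
  case fd =>
    intro j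
    by_cases hj : j = i
    · subst hj; rw [Function.update_self]; exact hYfd
    · rw [Function.update_of_ne hj]; exact H.fd j
  case fX =>
    intro k c hkc hlt' x hx
    obtain ⟨hk, hc'⟩ := hκ' k c hkc hlt'
    rw [Function.update_of_ne hk] at hx
    by_cases hc : c = i
    · subst hc
      simp only [if_true, Function.update_self]
      exact ⟨_, hsingN k hkc.symm x hx, rfl⟩
    · simp only [if_neg hc, Function.update_of_ne hc]
      exact H.fX k c hkc (hc' hc) x hx
  case φf =>
    intro k c hkc hlt' x hx
    obtain ⟨hk, hc'⟩ := hκ' k c hkc hlt'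
    rw [Function.update_of_ne hk] at hx
    rw [Function.update_of_ne hk]
    by_cases hc : c = i
    · subst hc
      simp only [if_true, Function.update_self]
      rw [LinearMap.comp_apply, hψ, hΦ, Finset.sum_eq_single k]
      · simp
      · intro j _ hj
        simp [hj]
      · simp
    · simp only [if_neg hc, Function.update_of_ne hc]
      exact H.φf k c hkc (hc' hc) x hx
  case φe =>
    intro j x hx
    by_cases hj : j = i
    · subst hj
      rw [Function.update_self] at hx ⊢
      exact hψe x hx
    · rw [Function.update_of_ne hj] at hx ⊢
      exact H.φe j x hx
  case φP =>
    intro j x hx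
    by_cases hj : j = i
    · subst hj
      rw [Function.update_self] at hx ⊢
      exact Submodule.mem_sup_right ⟨x, hx, rfl⟩
    · rw [Function.update_of_ne hj] at hx ⊢
      exact Submodule.mem_sup_left (H.φP j x hx)
  case Pfd =>
    have := H.Pfd
    infer_instance
  case es => exact Submodule.mem_sup_left H.es
  case eP =>
    intro j p hp
    obtain ⟨p1, hp1, p2, ⟨y, hy, rfl⟩, rfl⟩ := Submodule.mem_sup.1 hp
    rw [mul_add]
    refine add_mem (Submodule.mem_sup_left (H.eP j p1 hp1)) ?_
    rw [← hψe y hy, ← mul_assoc, hA.ee]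
    by_cases hj : j = i
    · subst hj; rw [if_pos rfl, hψe y hy]; exact Submodule.mem_sup_right ⟨y, hy, rfl⟩
    · rw [if_neg hj, zero_mul]; exact zero_mem _
  case bP =>
    intro k c p hp
    obtain ⟨p1, hp1, p2, ⟨y, hy, rfl⟩, rfl⟩ := Submodule.mem_sup.1 hp
    obtain ⟨p', hp', x, hx, h⟩ := H.bP k c p1 hp1
    rw [mul_add, h]
    by_cases hk : k = i
    · subst hk
      refine ⟨p' + b k c * φ k x, Submodule.mem_sup_left (add_mem hp' (biP c x hx)), y, ?_, ?_⟩
      · simpa using hy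
      · simp
    · refine ⟨p', Submodule.mem_sup_left hp', x, ?_, ?_⟩
      · rw [Function.update_of_ne hk]; exact hx
      · rw [bzero k c (ψ y) hk (hψe y hy), Function.update_of_ne hk, add_zero]
  case brick =>
    intro h hX hf
    have hXn : ∀ k, k ≠ i → ∀ x ∈ X k, h k x ∈ X k := by
      intro k hk x hx
      have := hX k x
      rw [Function.update_of_ne hk] at this
      exact this hx
    have hgsum : ∀ w : K → U, g w = ∑ j, g (Pi.single j (w j)) := by
      intro w
      rw [← map_sum, Finset.univ_sum_single]
    let hs : (K → U) →ₗ[ℂ] (K → U) := LinearMap.pi fun j => h j ∘ₗ LinearMap.proj j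
    have hhs : ∀ w j, hs w j = h j (w j) := fun w j => rfl
    have hgN : ∀ w ∈ N, g (hs w) = h i (g w) := by
      intro w hw
      rw [hgsum (hs w), hgsum w, map_sum]
      refine Finset.sum_congr rfl fun j _ => ?_
      have hwj : w j ∈ X0 j := hw j trivial
      rw [hhs]
      by_cases hj : G.Adj i j
      · rw [hX01 j hj] at hwj
        have := hf j i hj.symm (by
          rw [Function.update_self, Function.update_of_ne hj.ne']; exact hmax j) (w j)
          (by rw [Function.update_of_ne hj.ne']; exact hwj)
        simpa using this.symm
      · rw [hX02 j hj, Submodule.mem_bot] at hwj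
        rw [hwj]; simp
    have hso : ∀ x ∈ X i, ∃ x' ∈ X i, o x' = hs (o x) := by
      intro x hx
      rw [← hg0, hgN _ (hoN x hx), (hg0 _).2 ⟨x, hx, rfl⟩, map_zero]
    let hi : U →ₗ[ℂ] U := l ∘ₗ hs ∘ₗ o
    have hhi : ∀ x ∈ X i, hi x ∈ X i ∧ o (hi x) = hs (o x) := by
      intro x hx
      obtain ⟨x', hx', hox⟩ := hso x hx
      have : hi x = x' := by
        change l (hs (o x)) = x'
        rw [← hox, hl x' hx']
      rw [this]
      exact ⟨hx', hox⟩
    obtain ⟨c, hc⟩ := H.brick (Function.update h i hi)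
      (by
        intro k x hx
        by_cases hk : k = i
        · subst hk; rw [Function.update_self]; exact (hhi x hx).1
        · rw [Function.update_of_ne hk]; exact hXn k hk x hx)
      (by
        intro k c hkc hlt' x hx
        by_cases hc : c = i
        · subst hc
          exact absurd hlt' (not_lt.2 (hlt k hkc.symm).le)
        · rw [Function.update_of_ne hc]
          by_cases hk : k = i
          · subst hk
            rw [Function.update_self]
            have h1 := congrFun (hhi x hx).2 c
            rw [hhs, ho1 _ _ hkc, ho1 _ _ hkc, map_smul] at h1
            exact (smul_right_injective U (hA.ne c k hkc.symm) h1).symm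
          · rw [Function.update_of_ne hk]
            have := hf k c hkc (by
              rw [Function.update_of_ne hk, Function.update_of_ne hc]; exact hlt') x
              (by rw [Function.update_of_ne hk]; exact hx)
            simpa [hc] using this)
    refine ⟨c, fun k x hx => ?_⟩
    by_cases hk : k = i
    · subst hk
      rw [Function.update_self] at hx
      obtain ⟨w, hw, rfl⟩ := hx
      rw [← hgN w hw, ← map_smul]
      congr 1
      funext j
      rw [hhs, Pi.smul_apply]
      have hwj : w j ∈ X0 j := hw j trivial
      by_cases hj : G.Adj k j
      · rw [hX01 j hj] at hwj
        have := hc j (w j) hwj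
        rwa [Function.update_of_ne hj.ne'] at this
      · rw [hX02 j hj, Submodule.mem_bot] at hwj
        rw [hwj]; simp
    · rw [Function.update_of_ne hk] at hx
      have := hc k x hx
      rwa [Function.update_of_ne hk] at this

lemma good_init (G : SimpleGraph K) {A : Type} [Ring A] [Algebra ℂ A]
    {e : K → A} {b : K → K → A} {ε : K → K → ℂ} (hA : PPData G e b ε) (s : K)
    (κ : K → ℕ) (hmax : ∀ j, j ≠ s → κ j < κ s) : Good G e b s κ (Pi.single s 1) := by
  let u : U := Finsupp.single 0 1
  have hu : u ≠ 0 := by simp [u]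
  let X : K → Submodule ℂ U := fun j => if j = s then Submodule.span ℂ {u} else ⊥
  have hXs : X s = Submodule.span ℂ {u} := by simp [X]
  have hXn : ∀ j, j ≠ s → X j = ⊥ := fun j hj => by simp [X, hj]
  let φ : U →ₗ[ℂ] A := (Finsupp.lapply 0).smulRight (e s)
  have hφu : φ u = e s := by simp [φ, u]
  have hlast : ∀ k c, G.Adj k c → κ k < κ c → k ≠ s := by
    rintro k c hkc h rfl
    exact absurd h (not_lt.2 (hmax c hkc.ne').le)
  refine ⟨X, fun _ _ => 0, fun _ => φ, Submodule.span ℂ {e s}, ?_, ?_⟩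
  · constructor
    case fd =>
      intro j
      by_cases hj : j = s
      · rw [hj, hXs]; infer_instance
      · rw [hXn j hj]; infer_instance
    case fX => intro k c _ _ x _; simp
    case φf =>
      intro k c hkc h x hx
      rw [hXn k (hlast k c hkc h), Submodule.mem_bot] at hx
      simp [hx]
    case φe =>
      intro k x hx
      by_cases hk : k = s
      · subst hk
        rw [hXs] at hx
        obtain ⟨a, rfl⟩ := Submodule.mem_span_singleton.1 hx
        rw [map_smul, hφu, mul_smul_comm, hA.ee, if_pos rfl]
      · rw [hXn k hk, Submodule.mem_bot] at hx
        simp [hx]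
    case φP =>
      intro k x _
      exact Submodule.smul_mem _ _ (Submodule.mem_span_singleton_self _)
    case Pfd => infer_instance
    case es => exact Submodule.mem_span_singleton_self _
    case eP =>
      intro k p hp
      obtain ⟨a, rfl⟩ := Submodule.mem_span_singleton.1 hp
      rw [mul_smul_comm, hA.ee]
      by_cases hk : k = s
      · subst hk; rw [if_pos rfl]; exact hp
      · rw [if_neg hk, smul_zero]; exact zero_mem _
    case bP =>
      intro k c p hp
      obtain ⟨a, rfl⟩ := Submodule.mem_span_singleton.1 hp
      by_cases hk : k = s
      · subst hk
        refine ⟨0, zero_mem _, a • u, ?_, ?_⟩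
        · rw [hXs]; exact Submodule.smul_mem _ _ (Submodule.mem_span_singleton_self _)
        · rw [map_smul, hφu, zero_add]
      · refine ⟨0, zero_mem _, 0, zero_mem _, ?_⟩
        rw [← hA.be k c, mul_smul_comm, mul_assoc, hA.ee, if_neg hk]; simp
    case brick =>
      intro h hX _
      have h1 := hX s u (by rw [hXs]; exact Submodule.mem_span_singleton_self _)
      rw [hXs] at h1
      obtain ⟨c, hc⟩ := Submodule.mem_span_singleton.1 h1
      refine ⟨c, fun k x hx => ?_⟩
      by_cases hk : k = s
      · subst hk
        rw [hXs] at hx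
        obtain ⟨a, rfl⟩ := Submodule.mem_span_singleton.1 hx
        rw [map_smul, ← hc, smul_comm]
      · rw [hXn k hk, Submodule.mem_bot] at hx
        simp [hx]
  · intro j
    by_cases hj : j = s
    · subst hj; rw [hXs, finrank_span_singleton hu]; simp
    · rw [hXn j hj, finrank_bot]; simp [hj]

/-- Stamp of the vertex `i` at time `t`. -/
def stamp {n : ℕ} (ν : K ≃ Fin n) (t : ℕ) (i : K) : ℕ :=
  (ν i : ℕ) + n * ((t + (n - 1) - (ν i : ℕ)) / n)

lemma stamp_bounds {n : ℕ} (ν : K ≃ Fin n) (t : ℕ) (i : K) :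
    t ≤ stamp ν t i ∧ stamp ν t i < t + n := by
  have hi := (ν i).2
  have hn : 0 < n := by omega
  unfold stamp
  have h1 := Nat.div_add_mod (t + (n - 1) - (ν i : ℕ)) n
  have h2 := Nat.mod_lt (t + (n - 1) - (ν i : ℕ)) hn
  omega

lemma stamp_mod {n : ℕ} (ν : K ≃ Fin n) (t : ℕ) (i : K) : stamp ν t i % n = ν i := by
  unfold stamp
  rw [Nat.add_mul_mod_self_left, Nat.mod_eq_of_lt (ν i).2]

lemma eq_of_window {n t a c : ℕ} (ha : t ≤ a ∧ a < t + n) (hc : t ≤ c ∧ c < t + n)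
    (h : a % n = c % n) : a = c := by
  have h' : (a : ℤ) ≡ c [ZMOD n] := by
    have : a ≡ c [MOD n] := h
    exact (Int.natCast_modEq_iff).2 this
  have h2 : (n : ℤ) ∣ (c : ℤ) - a := h'.dvd
  have := Int.eq_zero_of_abs_lt_dvd h2 (by rw [abs_lt]; omega)
  omega

lemma done_all (G : SimpleGraph K) [DecidableRel G.Adj]
    (hG : ((2 : ℝ) • (1 : Matrix K K ℝ) - G.adjMatrix ℝ).PosDef)
    {A : Type} [Ring A] [Algebra ℂ A]
    {e : K → A} {b : K → K → A} {ε : K → K → ℂ} (hA : PPData G e b ε) (s : K) :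
    Done e b s := by
  by_contra hnd
  obtain ⟨n, ⟨ν⟩⟩ : ∃ n, Nonempty (K ≃ Fin n) := ⟨_, ⟨Fintype.equivFin K⟩⟩
  have hn : 0 < n := by have := (ν s).2; omega
  let v : ℕ → K := fun t => ν.symm ⟨t % n, Nat.mod_lt _ hn⟩
  have hv : ∀ t, (ν (v t) : ℕ) = t % n := fun t => by simp [v]
  have hvi : ∀ t i, (ν i : ℕ) = t % n → i = v t := fun t i hi =>
    ν.injective (Fin.ext (hi.trans (hv t).symm))
  have hstv : ∀ t, stamp ν t (v t) = t := fun t =>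
    eq_of_window (stamp_bounds ν t _) ⟨le_rfl, by omega⟩ (by rw [stamp_mod, hv])
  have hinj : ∀ t i j, stamp ν t i = stamp ν t j → i = j := by
    intro t i j h
    apply ν.injective
    apply Fin.ext
    rw [← stamp_mod ν t i, ← stamp_mod ν t j, h]
  have hupd : ∀ t, stamp ν (t + 1) = Function.update (stamp ν t) (v t) (t + n) := by
    intro t
    funext i
    by_cases hi : i = v t
    · subst hi
      rw [Function.update_self]
      exact eq_of_window (stamp_bounds ν (t+1) _) ⟨by omega, by omega⟩
        (by rw [stamp_mod, hv, Nat.add_mod_right])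
    · rw [Function.update_of_ne hi]
      have hb := stamp_bounds ν t i
      have hne : stamp ν t i ≠ t := fun h => hi (hinj t _ _ (h.trans (hstv t).symm))
      exact eq_of_window (stamp_bounds ν (t+1) _) ⟨by omega, by omega⟩
        (by rw [stamp_mod, stamp_mod])
  let stepd : ℕ → (K → ℕ) → (K → ℕ) := fun t d =>
    Function.update d (v t) ((∑ j, if G.Adj (v t) j then d j else 0) - d (v t))
  let t0 := (ν s : ℕ) + 1
  let d' : ℕ → K → ℕ := fun k => Nat.rec (Pi.single s 1) (fun k d => stepd (t0 + k) d) k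
  have hd's : ∀ k, d' (k+1) = stepd (t0 + k) (d' k) := fun k => rfl
  have hgood : ∀ k, Good G e b s (stamp ν (t0 + k)) (d' k) := by
    intro k
    induction k with
    | zero =>
      refine good_init G hA s _ fun j hj => ?_
      have h1 : stamp ν (t0 + 0) s = t0 + n - 1 :=
        eq_of_window (stamp_bounds ν _ _) ⟨by omega, by omega⟩ (by
          rw [stamp_mod]
          have : t0 + n - 1 = (ν s : ℕ) + n := by omega
          rw [this, Nat.add_mod_right, Nat.mod_eq_of_lt (ν s).2])
      have h2 := stamp_bounds ν (t0 + 0) j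
      have h3 : stamp ν (t0 + 0) j ≠ stamp ν (t0 + 0) s := fun h => hj (hinj _ _ _ h)
      omega
    | succ k ih =>
      have := (slice_step G hA s _ _ ih (v (t0 + k)) (t0 + k + n) (fun j hj => by
        have h2 := stamp_bounds ν (t0 + k) j
        have h3 : stamp ν (t0 + k) j ≠ stamp ν (t0 + k) (v (t0 + k)) := fun h => hj (hinj _ _ _ h)
        have h4 := hstv (t0 + k)
        omega) (fun j => (stamp_bounds ν (t0 + k) j).2) hnd).2
      rw [hd's, ← add_assoc, hupd]
      exact this
  have hle : ∀ k, d' k (v (t0 + k)) ≤ ∑ j, if G.Adj (v (t0 + k)) j then d' k j else 0 := by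
    intro k
    exact (slice_step G hA s _ _ (hgood k) (v (t0 + k)) (t0 + k + n) (fun j hj => by
        have h2 := stamp_bounds ν (t0 + k) j
        have h3 : stamp ν (t0 + k) j ≠ stamp ν (t0 + k) (v (t0 + k)) := fun h => hj (hinj _ _ _ h)
        have h4 := hstv (t0 + k)
        omega) (fun j => (stamp_bounds ν (t0 + k) j).2) hnd).1
  refine term_lemma G hG n hn ν (fun t => d' (t - t0)) t0 ?_ ?_ ?_
  · intro h
    have := congrFun h s
    simp [d'] at this
  · intro t ht i hi
    obtain ⟨k, rfl⟩ := Nat.exists_eq_add_of_le ht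
    rw [hvi _ i hi]
    have h1 : t0 + k - t0 = k := by omega
    have h2 : t0 + k + 1 - t0 = k + 1 := by omega
    simp only [h1, h2, hd's]
    have := hle k
    simp only [stepd, Function.update_self]
    omega
  · intro t ht i hi
    obtain ⟨k, rfl⟩ := Nat.exists_eq_add_of_le ht
    have h1 : t0 + k - t0 = k := by omega
    have h2 : t0 + k + 1 - t0 = k + 1 := by omega
    simp only [h1, h2, hd's]
    simp only [stepd]
    rw [Function.update_of_ne]
    rintro rfl
    exact hi (hv _)

/-- Left multiplication by generators determines stability under everything. -/
lemma stable_all {X A : Type} [Ring A] [Algebra ℂ A] (π : FreeAlgebra ℂ X →ₐ[ℂ] A)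
    (P : Submodule ℂ A) (h : ∀ x, ∀ p ∈ P, π (FreeAlgebra.ι ℂ x) * p ∈ P) (a : FreeAlgebra ℂ X) :
    ∀ p ∈ P, π a * p ∈ P := by
  induction a using FreeAlgebra.induction with
  | grade0 r =>
    intro p hp
    rw [AlgHom.commutes, ← Algebra.smul_def]
    exact P.smul_mem _ hp
  | grade1 x => exact h x
  | mul a c ha hc =>
    intro p hp
    rw [map_mul, mul_assoc]
    exact ha _ (hc _ hp)
  | add a c ha hc =>
    intro p hp
    rw [map_add, add_mul]
    exact P.add_mem (ha _ hp) (hc _ hp)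

/-- The preprojective algebra of a (possibly disconnected) finite-type
ADE Dynkin diagram is finite-dimensional over `ℂ`. -/
theorem stmt2 (G : SimpleGraph K) [DecidableRel G.Adj]
    (hG : ((2 : ℝ) • (1 : Matrix K K ℝ) - G.adjMatrix ℝ).PosDef)
    (ε : Arrow G → ℂ)
    (hε1 : ∀ a : Arrow G, ε a = 1 ∨ ε a = -1)
    (hε2 : ∀ a : Arrow G, ε (star a) = - ε a) :
    FiniteDimensional ℂ (Preproj G ε) := by
  let π : F G →ₐ[ℂ] Preproj G ε := RingQuot.mkAlgHom ℂ (relR G ε)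
  have hπ : ∀ x ∈ Rels G ε, π x = 0 := by
    intro x hx
    have h : π x = π 0 := RingQuot.mkAlgHom_rel ℂ (s := relR G ε) ⟨hx, rfl⟩
    rw [h, map_zero]
  let e : K → Preproj G ε := fun i => π (eIdem G i)
  let b : K → K → Preproj G ε := fun i j =>
    if h : G.Adj i j then π (arr G ⟨(i, j), h⟩) else 0
  let ε' : K → K → ℂ := fun i j => if h : G.Adj i j then ε ⟨(i, j), h⟩ else 0
  have hb : ∀ i j (h : G.Adj i j), b i j = π (arr G ⟨(i, j), h⟩) := fun i j h => dif_pos h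
  have hA : PPData G e b ε' := by
    constructor
    case ee =>
      intro i j
      have h := hπ _ (Or.inl ⟨i, j, rfl⟩)
      rw [map_sub, map_mul, sub_eq_zero] at h
      refine h.trans ?_
      split_ifs
      · rfl
      · exact map_zero _
    case bz => intro i j h; exact dif_neg h
    case eb =>
      intro i j
      by_cases hij : G.Adj i j
      · rw [hb i j hij]
        have h := hπ _ (Or.inr (Or.inr (Or.inl ⟨⟨(i, j), hij⟩, rfl⟩)))
        rw [map_sub, map_mul, sub_eq_zero] at h
        exact h
      · simp [b, hij]
    case be =>
      intro i j
      by_cases hij : G.Adj i j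
      · rw [hb i j hij]
        have h := hπ _ (Or.inr (Or.inr (Or.inr (Or.inl ⟨⟨(i, j), hij⟩, rfl⟩))))
        rw [map_sub, map_mul, sub_eq_zero] at h
        exact h
      · simp [b, hij]
    case rel =>
      intro i
      have h := hπ _ (Or.inr (Or.inr (Or.inr (Or.inr ⟨i, rfl⟩))))
      rw [map_sum] at h
      rw [← h]
      refine Finset.sum_congr rfl fun j _ => ?_
      by_cases hji : G.Adj j i
      · rw [dif_pos hji, map_smul, map_mul, hb j i hji, hb i j hji.symm]
        simp [ε', hji]
      · simp [ε', hji]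
    case ne =>
      intro i j h
      simp only [ε', dif_pos h]
      rcases hε1 ⟨(i, j), h⟩ with h | h <;> simp [h]
  have hsum : (1 : Preproj G ε) = ∑ i, e i := by
    have h := hπ _ (Or.inr (Or.inl rfl))
    rw [map_sub, map_one, map_sum, sub_eq_zero] at h
    exact h
  choose P hPfd hPe hPs hPb using fun s => done_all G hG hA s
  have htop : (⨆ s, P s) = ⊤ := by
    rw [eq_top_iff]
    rintro x -
    obtain ⟨a, rfl⟩ := RingQuot.mkAlgHom_surjective ℂ (relR G ε) x
    change π a ∈ _
    rw [← mul_one (π a), hsum, Finset.mul_sum]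
    refine Submodule.sum_mem _ fun s _ => ?_
    refine (le_iSup P s) (stable_all π (P s) ?_ a _ (hPe s))
    rintro (i | ⟨⟨i, j⟩, hij⟩) p hp
    · exact hPs s i p hp
    · have := hPb s i j p hp
      rw [hb i j hij] at this
      exact this
  have hfin : FiniteDimensional ℂ (↥(⨆ s, P s)) := Submodule.finiteDimensional_iSup P
  rw [htop] at hfin
  exact Module.finite_def.2 (Module.Finite.iff_fg.1 hfin)

end Stmt2
end
end

section
/- Let G be a finite undirected graph with vertex set K, without loops or multiple edges, such that the K×K matrix 2·Id − Adj(G) is positive definite (i.e. G is a possibly disconnected finite-type ADE Dynkin diagram), and let Π be its preprojective algebra. Let C ⊆ Π be the ℂ-linear span of all commutators x·y − y·x with x, y ∈ Π. Then Π is the internal direct sum of C and the ℂ-linear span of the vertex idempotents {e_i : i ∈ K}: every element of Π is the sum of an element of C and a ℂ-linear combination of the e_i, and the only such element lying in both subspaces is 0. Equivalently, the images of the e_i form a basis of the quotient vector space Π/C, so that Π/[Π,Π] ≅ ℂ^K. -/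
noncomputable section

open scoped BigOperators

namespace Stmt3

variable {K : Type} [Fintype K] [DecidableEq K]

/-- Arrows of the double quiver of a simple graph: an arrow `⟨(i,j), h⟩` goes from `i` to `j`. -/
def Arrow (G : SimpleGraph K) : Type := {p : K × K // G.Adj p.1 p.2}

/-- Source of an arrow. -/
abbrev src {G : SimpleGraph K} (a : Arrow G) : K := a.1.1

/-- Target of an arrow. -/
abbrev tgt {G : SimpleGraph K} (a : Arrow G) : K := a.1.2

/-- The reverse arrow `a*`. -/
def star {G : SimpleGraph K} (a : Arrow G) : Arrow G := ⟨(a.1.2, a.1.1), a.2.symm⟩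

/-- Generators of the free algebra: vertex idempotents and arrows of the double quiver. -/
def Gen (G : SimpleGraph K) : Type := K ⊕ Arrow G

/-- The free `ℂ`-algebra on the generators. -/
abbrev F (G : SimpleGraph K) : Type := FreeAlgebra ℂ (Gen G)

/-- The generator `e_i`. -/
def eIdem (G : SimpleGraph K) (i : K) : F G := FreeAlgebra.ι ℂ (Sum.inl i)

/-- The generator corresponding to an arrow. -/
def arr (G : SimpleGraph K) (a : Arrow G) : F G := FreeAlgebra.ι ℂ (Sum.inr a)

/-- The defining relations of the preprojective algebra. -/
def Rels (G : SimpleGraph K) [DecidableRel G.Adj] (ε : Arrow G → ℂ) : Set (F G) :=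
  {x | (∃ i j : K, x = eIdem G i * eIdem G j - if i = j then eIdem G i else 0) ∨
       (x = 1 - ∑ i : K, eIdem G i) ∨
       (∃ a : Arrow G, x = eIdem G (tgt a) * arr G a - arr G a) ∨
       (∃ a : Arrow G, x = arr G a * eIdem G (src a) - arr G a) ∨
       (∃ i : K, x = ∑ j : K,
          if h : G.Adj j i then
            ε ⟨(j, i), h⟩ • (arr G ⟨(j, i), h⟩ * arr G ⟨(i, j), h.symm⟩)
          else 0)}

/-- The relation whose `RingQuot` is the quotient by the two-sided ideal
generated by `Rels G ε`. -/
def relR (G : SimpleGraph K) [DecidableRel G.Adj] (ε : Arrow G → ℂ) :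
    F G → F G → Prop :=
  fun x y => x ∈ Rels G ε ∧ y = 0

/-- The preprojective algebra of `G`. -/
abbrev Preproj (G : SimpleGraph K) [DecidableRel G.Adj] (ε : Arrow G → ℂ) : Type :=
  RingQuot (relR G ε)


set_option linter.unusedSimpArgs false
section Alg
variable {A : Type*} [Ring A] [Algebra ℂ A]

/-- nonempty words in `a`, `b` -/
inductive Wd (a b : A) : A → Prop
  | a : Wd a b a
  | b : Wd a b b
  | am (w : A) : Wd a b w → Wd a b (a * w)
  | bm (w : A) : Wd a b w → Wd a b (b * w)

/-- the normal forms in the `E8` case -/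
def nf (a b : A) : Set A :=
  {z | ∃ k : ℕ, z = b ^ (k + 1) ∨ z = b ^ k * a ∨ z = b ^ k * (a * a) ∨ z = b ^ k * (a * a * a) ∨
    z = b ^ k * (a * b) ∨ z = b ^ k * (a * b * a) ∨ z = b ^ k * (a * b * a * a) ∨
    z = b ^ k * (a * b * a * b)}

theorem nf_stable_b (a b : A) (z : A) (hz : z ∈ Submodule.span ℂ (nf a b)) :
    b * z ∈ Submodule.span ℂ (nf a b) := by
  induction hz using Submodule.span_induction with
  | mem x h =>
    apply Submodule.subset_span
    obtain ⟨k, h⟩ := h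
    refine ⟨k + 1, ?_⟩
    rcases h with h | h | h | h | h | h | h | h <;> subst h <;> simp only [pow_succ' b, mul_assoc, true_or, or_true]
  | zero => simp
  | add x y _ _ hx hy => rw [mul_add]; exact Submodule.add_mem _ hx hy
  | smul c x _ hx => rw [mul_smul_comm]; exact Submodule.smul_mem _ _ hx

theorem nf_stable_a (a b : A)
    (r1 : a * a * b = - (a * b * a) - b * a * a) (r2 : a * b * b = - (b * a * b))
    (r3 : a * a * a * a = - (b * b * a)) 
    (r5 : b * a * a * a = - (b * b * b)) (r6 : b * a * a * b = 0)
    (r7 : b * a * b * a = - (b * b * a * a))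
    (z : A) (hz : z ∈ Submodule.span ℂ (nf a b)) :
    a * z ∈ Submodule.span ℂ (nf a b) := by
  have hb := nf_stable_b a b
  have mk : ∀ z, z ∈ nf a b → z ∈ Submodule.span ℂ (nf a b) := fun z h => Submodule.subset_span h
  have key : ∀ w : A, a * w ∈ Submodule.span ℂ (nf a b) → a * (b * w) ∈ Submodule.span ℂ (nf a b) →
      ∀ k, a * (b ^ k * w) ∈ Submodule.span ℂ (nf a b) := by
    intro w h0 h1 k
    induction k using Nat.twoStepInduction with
    | zero => simpa using h0
    | one => simpa using h1
    | more k _ ih =>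
      have : a * (b ^ (k + 2) * w) = - (b * (a * (b ^ (k + 1) * w))) := by
        calc a * (b ^ (k + 2) * w) = (a * b * b) * (b ^ k * w) := by
              simp only [pow_succ' b, mul_assoc]
          _ = _ := by rw [r2]; simp only [pow_succ' b, mul_assoc, neg_mul]
      rw [this]; exact Submodule.neg_mem _ (hb _ ih)
  -- basic elements
  have n_b1 : ∀ k, b ^ (k + 1) ∈ Submodule.span ℂ (nf a b) := fun k => mk _ ⟨k, by simp⟩
  have n_a : ∀ k, b ^ k * a ∈ Submodule.span ℂ (nf a b) := fun k => mk _ ⟨k, by simp⟩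
  have n_aa : ∀ k, b ^ k * (a * a) ∈ Submodule.span ℂ (nf a b) := fun k => mk _ ⟨k, by simp⟩
  have n_aaa : ∀ k, b ^ k * (a * a * a) ∈ Submodule.span ℂ (nf a b) := fun k => mk _ ⟨k, by simp⟩
  have n_ab : ∀ k, b ^ k * (a * b) ∈ Submodule.span ℂ (nf a b) := fun k => mk _ ⟨k, by simp⟩
  have n_aba : ∀ k, b ^ k * (a * b * a) ∈ Submodule.span ℂ (nf a b) := fun k => mk _ ⟨k, by simp⟩
  have n_abaa : ∀ k, b ^ k * (a * b * a * a) ∈ Submodule.span ℂ (nf a b) := fun k => mk _ ⟨k, by simp⟩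
  have n_abab : ∀ k, b ^ k * (a * b * a * b) ∈ Submodule.span ℂ (nf a b) := fun k => mk _ ⟨k, by simp⟩
  have abbb : a * b * b * b = b * b * (a * b) := by
    rw [r2]; calc - (b * a * b) * b = - (b * (a * b * b)) := by noncomm_ring
      _ = _ := by rw [r2]; noncomm_ring
  have abaaa : a * b * a * a * a = - (b * b * (a * b)) := by
    calc a * b * a * a * a = a * (b * a * a * a) := by noncomm_ring
      _ = - (a * b * b * b) := by rw [r5]; noncomm_ring
      _ = _ := by rw [abbb]
  have ababa : a * b * a * b * a = b * b * b * b := by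
    calc a * b * a * b * a = a * (b * a * b * a) := by noncomm_ring
      _ = - (a * b * b) * a * a := by rw [r7]; noncomm_ring
      _ = b * a * b * a * a := by rw [r2]; noncomm_ring
      _ = - (b * (b * a * a * a)) := by rw [r7]; noncomm_ring
      _ = _ := by rw [r5]; noncomm_ring
  have babab : b * a * b * a * b = 0 := by
    rw [r7]; calc - (b * b * a * a) * b = - (b * (b * a * a * b)) := by noncomm_ring
      _ = 0 := by rw [r6]; simp
  induction hz using Submodule.span_induction with
  | mem x h =>
    obtain ⟨k, h⟩ := h
    rcases h with h | h | h | h | h | h | h | h <;> subst h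
    · rw [pow_succ]
      refine key b ?_ ?_ k
      · simpa using n_ab 0
      · have : a * (b * b) = - (b ^ 1 * (a * b)) := by rw [← mul_assoc, r2]; noncomm_ring
        rw [this]; exact Submodule.neg_mem _ (n_ab 1)
    · refine key a ?_ ?_ k
      · simpa using n_aa 0
      · simpa [mul_assoc] using n_aba 0
    · refine key _ ?_ ?_ k
      · simpa [mul_assoc] using n_aaa 0
      · simpa [mul_assoc] using n_abaa 0
    · refine key _ ?_ ?_ k
      · have : a * (a * a * a) = - (b ^ 2 * a) := by
          rw [pow_two, ← r3]; noncomm_ring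
        rw [this]; exact Submodule.neg_mem _ (n_a 2)
      · have : a * (b * (a * a * a)) = - (b ^ 2 * (a * b)) := by
          rw [pow_two, ← abaaa]; noncomm_ring
        rw [this]; exact Submodule.neg_mem _ (n_ab 2)
    · refine key _ ?_ ?_ k
      · have : a * (a * b) = - (b ^ 0 * (a * b * a)) - b ^ 1 * (a * a) := by
          rw [← mul_assoc, r1]; noncomm_ring
        rw [this]; exact Submodule.sub_mem _ (Submodule.neg_mem _ (n_aba 0)) (n_aa 1)
      · simpa [mul_assoc] using n_abab 0
    · refine key _ ?_ ?_ k
      · have : a * (a * b * a) = - (b ^ 0 * (a * b * a * a)) - b ^ 1 * (a * a * a) := by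
          calc a * (a * b * a) = (a * a * b) * a := by noncomm_ring
            _ = _ := by rw [r1]; noncomm_ring
        rw [this]; exact Submodule.sub_mem _ (Submodule.neg_mem _ (n_abaa 0)) (n_aaa 1)
      · have : a * (b * (a * b * a)) = b ^ (3 + 1) := by
          calc a * (b * (a * b * a)) = a * b * a * b * a := by noncomm_ring
            _ = _ := by rw [ababa]; noncomm_ring
        rw [this]; exact n_b1 3
    · refine key _ ?_ ?_ k
      · have : a * (a * b * a * a) = b ^ 2 * (a * b) + b ^ 3 * a := by
          calc a * (a * b * a * a) = (a * a * b) * a * a := by noncomm_ring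
            _ = - (a * b * a * a * a) - (b * a * a * a) * a := by rw [r1]; noncomm_ring
            _ = _ := by rw [abaaa, r5]; noncomm_ring
        rw [this]; exact Submodule.add_mem _ (n_ab 2) (n_a 3)
      · have : a * (b * (a * b * a * a)) = b ^ 4 * a := by
          calc a * (b * (a * b * a * a)) = a * b * a * b * a * a := by noncomm_ring
            _ = _ := by rw [ababa]; noncomm_ring
        rw [this]; exact n_a 4
    · refine key _ ?_ ?_ k
      · have : a * (a * b * a * b) = b ^ (3 + 1) := by
          calc a * (a * b * a * b) = (a * a * b) * a * b := by noncomm_ring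
            _ = - (a * (b * a * a * b)) - (b * a * a * a) * b := by rw [r1]; noncomm_ring
            _ = _ := by rw [r6, r5]; noncomm_ring
        rw [this]; exact n_b1 3
      · have : a * (b * (a * b * a * b)) = 0 := by
          calc a * (b * (a * b * a * b)) = a * (b * a * b * a * b) := by noncomm_ring
            _ = _ := by rw [babab]; simp
        rw [this]; simp
  | zero => simp
  | add x y _ _ hx hy => rw [mul_add]; exact Submodule.add_mem _ hx hy
  | smul c x _ hx => rw [mul_smul_comm]; exact Submodule.smul_mem _ _ hx

theorem wd_mem_nf (a b : A)
    (r1 : a * a * b = - (a * b * a) - b * a * a) (r2 : a * b * b = - (b * a * b))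
    (r3 : a * a * a * a = - (b * b * a)) 
    (r5 : b * a * a * a = - (b * b * b)) (r6 : b * a * a * b = 0)
    (r7 : b * a * b * a = - (b * b * a * a))
    (z : A) (hz : Wd a b z) :
    z ∈ Submodule.span ℂ (nf a b) := by
  induction hz with
  | a => exact Submodule.subset_span ⟨0, by simp⟩
  | b => exact Submodule.subset_span ⟨0, by simp⟩
  | am w _ ih => exact nf_stable_a a b r1 r2 r3 r5 r6 r7 w ih
  | bm w _ ih => exact nf_stable_b a b w ih

/-- all normal forms are traceless -/
theorem nf_trace (a b : A) {V : Type*} [AddCommGroup V] [Module ℂ V] (τ : A →ₗ[ℂ] V)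
    (hτ : ∀ x y, τ (x * y) = τ (y * x))
    (r1 : a * a * b = - (a * b * a) - b * a * a) (r2 : a * b * b = - (b * a * b))
    (r5 : b * a * a * a = - (b * b * b)) (r6 : b * a * a * b = 0)
    (r7 : b * a * b * a = - (b * b * a * a))
    (t1 : τ a = 0) (t2 : τ (a * a) = 0) (t3 : τ (a * a * a) = 0) (t4 : τ b = 0)
    (t5 : τ (b * b) = 0) (t6 : τ (b * a) = 0)
    (z : A) (hz : z ∈ Submodule.span ℂ (nf a b)) : τ z = 0 := by
  have two : ∀ v : V, v = - v → v = 0 := fun v h => by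
    have : (2 : ℂ) • v = 0 := by rw [two_smul]; nth_rw 2 [h]; simp
    simpa using this
  have three : ∀ v : V, v + v + v = 0 → v = 0 := fun v h => by
    have : (3 : ℂ) • v = 0 := by rw [← h]; module
    simpa using this
  have babaa : b * a * b * a * a = b * b * b * b := by
    rw [r7]
    calc - (b * b * a * a) * a = - (b * (b * a * a * a)) := by noncomm_ring
      _ = _ := by rw [r5]; noncomm_ring
  have babab : b * a * b * a * b = 0 := by
    rw [r7]; calc - (b * b * a * a) * b = - (b * (b * a * a * b)) := by noncomm_ring
      _ = 0 := by rw [r6]; simp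
  have ababa : a * b * a * b * a = b * b * b * b := by
    calc a * b * a * b * a = a * (b * a * b * a) := by noncomm_ring
      _ = - (a * b * b) * a * a := by rw [r7]; noncomm_ring
      _ = b * a * b * a * a := by rw [r2]; noncomm_ring
      _ = _ := babaa
  have b5 : b * b * b * b * b = 0 := by
    calc b * b * b * b * b = b * (b * b * b * b) := by noncomm_ring
      _ = (b * a * b * a * b) * a := by rw [← ababa]; noncomm_ring
      _ = 0 := by rw [babab]; simp
  have b5' : ∀ k, b ^ (k + 5) = 0 := fun k => by
    rw [pow_add]
    have : b ^ 5 = b * b * b * b * b := by noncomm_ring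
    rw [this, b5, mul_zero]
  have rot : ∀ p q r s : A, p * q = r → q * p = s → τ r = τ s := by
    rintro p q r s rfl rfl; exact hτ p q
  have u1 : τ (b * a * a) = 0 := by
    apply three
    have h := congrArg τ r1
    rw [map_sub, map_neg, rot (a * a) b _ (b * a * a) rfl (by noncomm_ring),
      rot a (b * a) (a * b * a) (b * a * a) (by noncomm_ring) rfl] at h
    nth_rw 1 [h]; abel
  have u2 : τ (b * b * b) = 0 := by
    have h0 : τ (b * a * a * a) = 0 := by
      apply three
      have h := congrArg (fun y => τ (y * a)) r1
      simp only [sub_mul, neg_mul] at h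
      rw [map_sub, map_neg, rot (a * a) (b * a) _ (b * a * a * a) (by noncomm_ring) (by noncomm_ring),
        rot a (b * a * a) (a * b * a * a) (b * a * a * a) (by noncomm_ring) rfl] at h
      nth_rw 1 [h]; abel
    rw [r5, map_neg, neg_eq_zero] at h0
    exact h0
  have u3 : τ (b * b * b * b) = 0 := by
    have h := congrArg (fun y => τ (y * (a * b))) r1
    simp only [sub_mul, neg_mul] at h
    rw [map_sub, map_neg,
      rot a (a * b * a * b) (a * a * b * (a * b)) ((a * b) * (a * b * a)) (by noncomm_ring)
        (by noncomm_ring),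
      rot (a * b * a) (a * b) (a * b * a * (a * b)) ((a * b) * (a * b * a)) (by noncomm_ring)
        (by noncomm_ring),
      rot (a * b) (a * b * a) (a * b * (a * b * a)) (a * (b * a * a * b)) rfl (by noncomm_ring), r6] at h
    have h2 : b * a * a * (a * b) = - (b * b * b * b) := by
      rw [← mul_assoc, r5]; noncomm_ring
    rw [h2] at h
    simpa using h.symm
  have v2 : τ (b * b * a) = 0 := by
    apply two
    have h := congrArg τ r2
    rw [map_neg, rot a (b * b) _ (b * b * a) (by noncomm_ring) rfl,
      rot (b * a) b _ (b * b * a) rfl (by noncomm_ring)] at h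
    exact h
  have v3 : τ (b * b * b * a) = 0 := by
    apply two
    have h := congrArg (fun y => τ (b * y)) r2
    simp only [mul_neg] at h
    rw [map_neg, rot (b * a) (b * b) _ (b * b * b * a) (by noncomm_ring) (by noncomm_ring),
      rot (b * b * a) b (b * (b * a * b)) (b * b * b * a) (by noncomm_ring) (by noncomm_ring)] at h
    exact h
  have v4 : τ (b * b * b * b * a) = 0 := by
    apply two
    have h := congrArg (fun y => τ (y * (b * b))) r2
    simp only [neg_mul] at h
    rw [map_neg, rot a (b * b * b * b) _ (b * b * b * b * a) (by noncomm_ring) (by noncomm_ring),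
      rot (b * a) (b * b * b) (b * a * b * (b * b)) (b * b * b * b * a) (by noncomm_ring) (by noncomm_ring)] at h
    exact h
  have hb : ∀ k, τ (b ^ (k + 1)) = 0 := by
    intro k
    match k with
    | 0 => simpa using t4
    | 1 => simpa [pow_succ] using t5
    | 2 => simpa [pow_succ] using u2
    | 3 => simpa [pow_succ] using u3
    | k + 4 => rw [show k + 4 + 1 = k + 5 from rfl, b5']; simp
  have ha : ∀ k, τ (b ^ k * a) = 0 := by
    intro k
    match k with
    | 0 => simpa using t1
    | 1 => simpa [pow_succ] using t6
    | 2 => simpa [pow_succ] using v2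
    | 3 => simpa [pow_succ] using v3
    | 4 => simpa [pow_succ] using v4
    | k + 5 => rw [b5']; simp
  have haa : ∀ k, τ (b ^ k * (a * a)) = 0 := by
    intro k
    match k with
    | 0 => simpa using t2
    | 1 => simpa [pow_succ, ← mul_assoc] using u1
    | k + 2 =>
      have : b ^ (k + 2) * (a * a) = b ^ (k + 1) * (b * a * a) := by
        rw [pow_succ]; noncomm_ring
      rw [this, hτ, pow_succ' b, ← mul_assoc, r6]; simp
  induction hz using Submodule.span_induction with
  | mem x h =>
    obtain ⟨k, h⟩ := h
    rcases h with h | h | h | h | h | h | h | h <;> subst h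
    · exact hb k
    · exact ha k
    · exact haa k
    · cases k with
      | zero => simpa using t3
      | succ k =>
        have : b ^ (k + 1) * (a * a * a) = - b ^ ((k + 2) + 1) := by
          calc b ^ (k + 1) * (a * a * a) = b ^ k * (b * a * a * a) := by
                rw [pow_succ]; noncomm_ring
            _ = _ := by rw [r5]; simp only [pow_succ]; noncomm_ring
        rw [this, map_neg, hb, neg_zero]
    · rw [← mul_assoc, hτ, ← mul_assoc, ← pow_succ']; exact ha _
    · cases k with
      | zero => 
        rw [pow_zero, one_mul, mul_assoc, hτ]; exact u1
      | succ k =>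
        have : b ^ (k + 1) * (a * b * a) = - (b ^ (k + 2) * (a * a)) := by
          calc b ^ (k + 1) * (a * b * a) = b ^ k * (b * a * b * a) := by
                rw [pow_succ]; noncomm_ring
            _ = _ := by rw [r7]; simp only [pow_succ]; noncomm_ring
        rw [this, map_neg, haa, neg_zero]
    · cases k with
      | zero => 
        rw [pow_zero, one_mul]
        have : a * b * a * a = a * (b * a * a) := by noncomm_ring
        rw [this, hτ, r5, map_neg, u2, neg_zero]
      | succ k =>
        have : b ^ (k + 1) * (a * b * a * a) = b ^ ((k + 3) + 1) := by
          calc b ^ (k + 1) * (a * b * a * a) = b ^ k * (b * a * b * a * a) := by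
                rw [pow_succ]; noncomm_ring
            _ = _ := by rw [babaa]; simp only [pow_succ]; noncomm_ring
        rw [this, hb]
    · cases k with
      | zero => 
        rw [pow_zero, one_mul]
        rw [hτ, ← mul_assoc, ← mul_assoc, r7, map_neg, mul_assoc, ← pow_two b, haa, neg_zero]
      | succ k =>
        have : b ^ (k + 1) * (a * b * a * b) = b ^ k * (b * a * b * a * b) := by
                rw [pow_succ]; noncomm_ring
        rw [this, babab]; simp
  | zero => simp
  | add x y _ _ hx hy => rw [map_add, hx, hy, add_zero]
  | smul c x _ hx => rw [map_smul, hx, smul_zero]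

theorem e8_trace (u x : A) {V : Type*} [AddCommGroup V] [Module ℂ V] (τ : A →ₗ[ℂ] V)
    (hτ : ∀ x y, τ (x * y) = τ (y * x))
    (hu : u * u = 0) (hx : x * (x * x) = 0) (h5 : (u + x) ^ 5 = 0)
    (tu : τ u = 0) (tx : τ x = 0) (txx : τ (x * x) = 0)
    (t2 : τ ((u + x) ^ 2) = 0) (t3 : τ ((u + x) ^ 3) = 0) (t4 : τ ((u + x) ^ 4) = 0)
    (z : A) (hz : Wd u x z) : τ z = 0 := by
  have two : ∀ v : V, v + v = 0 → v = 0 := fun v h => by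
    have : (2 : ℂ) • v = 0 := by rw [← h]; module
    simpa using this
  have three : ∀ v : V, v + v + v = 0 → v = 0 := fun v h => by
    have : (3 : ℂ) • v = 0 := by rw [← h]; module
    simpa using this
  have rot : ∀ p q r s : A, p * q = r → q * p = s → τ r = τ s := by
    rintro p q r s rfl rfl; exact hτ p q
  have hu' : ∀ t, u * (u * t) = 0 := fun t => by rw [← mul_assoc, hu, zero_mul]
  have hx' : ∀ t, x * (x * (x * t)) = 0 := fun t => by
    rw [show x * (x * (x * t)) = x * (x * x) * t by noncomm_ring, hx, zero_mul]
  obtain ⟨a, ha⟩ : ∃ a, a = u * x := ⟨_, rfl⟩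
  obtain ⟨b, hb⟩ : ∃ b, b = u * (x * x) := ⟨_, rfl⟩
  have R := h5
  simp only [pow_succ, pow_zero, one_mul, mul_add, add_mul, mul_assoc, hu, hu', hx, hx', mul_zero, add_zero,
    zero_add] at R
  have r1 : a * a * b = - (a * b * a) - b * a * a := by
    have h := congrArg (fun y => u * (y * x)) R
    simp only [mul_add, add_mul, mul_assoc, hu, hu', hx, hx', mul_zero, add_zero,
      zero_add, zero_mul] at h
    subst ha hb
    rw [← sub_eq_zero, ← h]
    noncomm_ring
  have r2 : a * b * b = - (b * a * b) := by
    have h := congrArg (fun y => u * (y * (x * x))) R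
    simp only [mul_add, add_mul, mul_assoc, hu, hu', hx, hx', mul_zero, add_zero,
      zero_add, zero_mul] at h
    subst ha hb
    rw [← sub_eq_zero, ← h]
    noncomm_ring
  have r3 : a * a * a * a = - (b * b * a) := by
    have h := congrArg (fun y => u * (y * (u * x))) R
    simp only [mul_add, add_mul, mul_assoc, hu, hu', hx, hx', mul_zero, add_zero,
      zero_add, zero_mul] at h
    subst ha hb
    rw [← sub_eq_zero, ← h]
    noncomm_ring
  have r5 : b * a * a * a = - (b * b * b) := by
    have h := congrArg (fun y => u * (x * (x * (y * x)))) R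
    simp only [mul_add, add_mul, mul_assoc, hu, hu', hx, hx', mul_zero, add_zero,
      zero_add, zero_mul] at h
    subst ha hb
    rw [← sub_eq_zero, ← h]
    noncomm_ring
  have r6 : b * a * a * b = 0 := by
    have h := congrArg (fun y => u * (x * (x * (y * (x * x))))) R
    simp only [mul_add, add_mul, mul_assoc, hu, hu', hx, hx', mul_zero, add_zero,
      zero_add, zero_mul] at h
    subst ha hb
    rw [← h]
    noncomm_ring
  have r7 : b * a * b * a = - (b * b * a * a) := by
    have h := congrArg (fun y => u * (x * (x * (y * (u * x))))) R
    simp only [mul_add, add_mul, mul_assoc, hu, hu', hx, hx', mul_zero, add_zero,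
      zero_add, zero_mul] at h
    subst ha hb
    rw [← sub_eq_zero, ← h]
    noncomm_ring
  have ta : τ a = 0 := by
    apply two
    simp only [pow_succ, pow_zero, one_mul, mul_add, add_mul, mul_assoc, hu, hu', hx, hx', mul_zero,
      add_zero, zero_add, map_add, txx] at t2
    rw [hτ x u, ← ha] at t2
    exact t2
  have tb : τ b = 0 := by
    apply three
    simp only [pow_succ, pow_zero, one_mul, mul_add, add_mul, mul_assoc, hu, hu', hx, hx', mul_zero,
      add_zero, zero_add, map_add, txx] at t3
    rw [rot u (x * u) _ 0 rfl (by rw [mul_assoc, hu, mul_zero]), rot x (u * x) _ b rfl (by rw [hb, mul_assoc]),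
      rot (x * x) u (x * (x * u)) b (by noncomm_ring) hb.symm, ← hb] at t3
    simpa [add_assoc] using t3
  have taa : τ (a * a) = 0 := by
    apply two
    simp only [pow_succ, pow_zero, one_mul, mul_add, add_mul, mul_assoc, hu, hu', hx, hx', mul_zero,
      add_zero, zero_add, map_add, txx] at t4
    rw [rot u (x * (x * u)) _ 0 rfl (by simp only [mul_assoc, hu, mul_zero]),
      rot x (u * (x * x)) (x * (u * (x * x))) 0 rfl (by simp only [mul_assoc, hx, mul_zero]),
      rot (x * x) (u * x) (x * (x * (u * x))) 0 (by noncomm_ring) (by simp only [mul_assoc, hx, mul_zero]),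
      rot x (u * (x * u)) (x * (u * (x * u))) (a * a) rfl (by rw [ha]; noncomm_ring),
      show u * (x * (u * x)) = a * a by rw [ha]; noncomm_ring] at t4
    simpa using t4
  have tba : τ (b * a) = 0 := by
    have h := congrArg τ R
    simp only [map_add, map_zero] at h
    rw [rot (u * (x * (u * x))) u (u * (x * (u * (x * u)))) 0 (by noncomm_ring) (hu' _),
      rot (x * (x * (u * x))) u (x * (x * (u * (x * u)))) (b * a) (by noncomm_ring)
        (by subst ha hb; noncomm_ring),
      rot x (u * (x * (x * u))) (x * (u * (x * (x * u)))) (b * a) (by noncomm_ring)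
        (by subst ha hb; noncomm_ring),
      rot (x * (u * x)) (u * x) (x * (u * (x * (u * x)))) (b * a) (by noncomm_ring)
        (by subst ha hb; noncomm_ring),
      rot (u * x) (u * (x * x)) (u * (x * (u * (x * x)))) (b * a) (by noncomm_ring)
        (by subst ha hb; noncomm_ring),
      rot x (x * (u * (x * x))) (x * (x * (u * (x * x)))) 0 (by noncomm_ring)
        (by simp only [mul_assoc, hx, mul_zero]),
      show u * (x * (x * (u * x))) = b * a by subst ha hb; noncomm_ring, map_zero] at h
    have : (5 : ℂ) • τ (b * a) = 0 := by rw [← h]; module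
    simpa using this
  have tbb : τ (b * b) = 0 ∧ τ (a * a * a) = 0 := by
    have h1 := congrArg (fun y => τ (u * y)) R
    have h2 := congrArg (fun y => τ (y * x)) R
    simp only [mul_add, add_mul, mul_assoc, hu, hu', hx, hx', mul_zero, add_zero,
      zero_add, zero_mul, map_add, map_zero] at h1 h2
    rw [rot (u * (x * (x * (u * x)))) u (u * (x * (x * (u * (x * u))))) 0 (by noncomm_ring) (hu' _),
      rot (u * (x * (u * (x * x)))) u (u * (x * (u * (x * (x * u))))) 0 (by noncomm_ring) (hu' _),
      show u * (x * (u * (x * (u * x)))) = a * a * a by subst ha; noncomm_ring,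
      show u * (x * (x * (u * (x * x)))) = b * b by subst hb; noncomm_ring] at h1
    rw [rot (x * x) (u * (x * (u * x))) (x * (x * (u * (x * (u * x))))) 0 (by noncomm_ring)
        (by simp only [mul_assoc, hx, mul_zero]),
      rot x (u * (x * (u * (x * x)))) (x * (u * (x * (u * (x * x))))) 0 (by noncomm_ring)
        (by simp only [mul_assoc, hx, mul_zero]),
      rot x (u * (x * (x * (u * x)))) (x * (u * (x * (x * (u * x))))) (b * b) (by noncomm_ring)
        (by subst hb; noncomm_ring),
      show u * (x * (u * (x * (u * x)))) = a * a * a by subst ha; noncomm_ring,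
      show u * (x * (x * (u * (x * x)))) = b * b by subst hb; noncomm_ring] at h2
    simp only [map_zero, zero_add, add_zero] at h1 h2
    have hbb : τ (b * b) = 0 := by
      have h3 := sub_eq_zero.mpr (h2.trans h1.symm)
      rw [← h3]; abel
    rw [hbb, add_zero] at h1
    exact ⟨hbb, h1⟩
  have hT : ∀ w, Wd a b w → τ w = 0 := fun w hw =>
    nf_trace a b τ hτ r1 r2 r5 r6 r7 ta taa tbb.2 tb tbb.1 tba w
      (wd_mem_nf a b r1 r2 r3 r5 r6 r7 w hw)
  have hua : u * a = 0 := by rw [ha, hu']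
  have hub : u * b = 0 := by rw [hb, hu']
  have huw : ∀ w, Wd a b w → u * w = 0 := fun w hw => by
    cases hw with
    | a => exact hua
    | b => exact hub
    | am w _ => rw [← mul_assoc, hua, zero_mul]
    | bm w _ => rw [← mul_assoc, hub, zero_mul]
  have hwx : ∀ w, Wd a b w → Wd a b (w * x) ∨ w * x = 0 := fun w hw => by
    induction hw with
    | a => left; rw [show a * x = b by rw [ha, hb, mul_assoc]]; exact Wd.b
    | b => right; simp only [hb, mul_assoc, hx, mul_zero]
    | am w _ ih =>
      rw [mul_assoc]
      rcases ih with ih | ih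
      · left; exact Wd.am _ ih
      · right; rw [ih, mul_zero]
    | bm w _ ih =>
      rw [mul_assoc]
      rcases ih with ih | ih
      · left; exact Wd.bm _ ih
      · right; rw [ih, mul_zero]
  have main : z = 0 ∨ z = u ∨ z = x ∨ z = x * x ∨ z = x * u ∨ z = x * (x * u) ∨
      ∃ s, Wd a b s ∧ (z = s ∨ z = x * s ∨ z = x * (x * s) ∨ z = s * u ∨ z = x * (s * u) ∨
        z = x * (x * (s * u))) := by
    induction hz with
    | a => simp
    | b => simp
    | am w _ ih =>
      rcases ih with h | h | h | h | h | h | ⟨s, hs, h | h | h | h | h | h⟩ <;> subst h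
      · simp
      · simp [hu]
      · exact Or.inr (Or.inr (Or.inr (Or.inr (Or.inr (Or.inr ⟨a, Wd.a, by simp [ha]⟩)))))
      · exact Or.inr (Or.inr (Or.inr (Or.inr (Or.inr (Or.inr ⟨b, Wd.b, by simp [hb]⟩)))))
      · exact Or.inr (Or.inr (Or.inr (Or.inr (Or.inr (Or.inr ⟨a, Wd.a, by simp [ha, mul_assoc]⟩)))))
      · exact Or.inr (Or.inr (Or.inr (Or.inr (Or.inr (Or.inr ⟨b, Wd.b, by simp [hb, mul_assoc]⟩)))))
      · left; exact huw _ hs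
      · exact Or.inr (Or.inr (Or.inr (Or.inr (Or.inr (Or.inr ⟨a * s, Wd.am _ hs, by simp [ha, mul_assoc]⟩)))))
      · exact Or.inr (Or.inr (Or.inr (Or.inr (Or.inr (Or.inr ⟨b * s, Wd.bm _ hs, by simp [hb, mul_assoc]⟩)))))
      · left; rw [← mul_assoc, huw _ hs, zero_mul]
      · exact Or.inr (Or.inr (Or.inr (Or.inr (Or.inr (Or.inr ⟨a * s, Wd.am _ hs, by simp [ha, mul_assoc]⟩)))))
      · exact Or.inr (Or.inr (Or.inr (Or.inr (Or.inr (Or.inr ⟨b * s, Wd.bm _ hs, by simp [hb, mul_assoc]⟩)))))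
    | bm w _ ih =>
      rcases ih with h | h | h | h | h | h | ⟨s, hs, h | h | h | h | h | h⟩ <;> subst h
      · simp
      · simp
      · simp
      · simp [hx]
      · simp
      · simp [hx']
      · exact Or.inr (Or.inr (Or.inr (Or.inr (Or.inr (Or.inr ⟨_, hs, by simp⟩)))))
      · exact Or.inr (Or.inr (Or.inr (Or.inr (Or.inr (Or.inr ⟨s, hs, by simp⟩)))))
      · simp [hx']
      · exact Or.inr (Or.inr (Or.inr (Or.inr (Or.inr (Or.inr ⟨s, hs, by simp⟩)))))
      · exact Or.inr (Or.inr (Or.inr (Or.inr (Or.inr (Or.inr ⟨s, hs, by simp⟩)))))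
      · simp [hx']
  rcases main with h | h | h | h | h | h | ⟨s, hs, h | h | h | h | h | h⟩ <;> subst h
  · simp
  · exact tu
  · exact tx
  · exact txx
  · rw [hτ, ← ha]; exact ta
  · rw [← mul_assoc, hτ, ← hb]; exact tb
  · exact hT _ hs
  · rw [hτ]
    rcases hwx _ hs with h | h
    · exact hT _ h
    · rw [h, map_zero]
  · rw [← mul_assoc, hτ, ← mul_assoc]
    rcases hwx _ hs with h | h
    · rcases hwx _ h with h | h
      · exact hT _ h
      · rw [h, map_zero]
    · rw [h, zero_mul, map_zero]
  · rw [hτ, huw _ hs, map_zero]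
  · rw [← mul_assoc, hτ, ← mul_assoc, ← ha]; exact hT _ (Wd.am _ hs)
  · rw [show x * (x * (s * u)) = (x * x * s) * u by noncomm_ring, hτ, ← mul_assoc, ← hb]
    exact hT _ (Wd.bm _ hs)

theorem d_trace (u v : A) {V : Type*} [AddCommGroup V] [Module ℂ V] (τ : A →ₗ[ℂ] V)
    (hτ : ∀ x y, τ (x * y) = τ (y * x))
    (hu : u * u = 0) (hv : v * v = 0)
    (tu : τ u = 0) (tv : τ v = 0)
    (t : ∀ k, τ ((u + v) ^ (k + 1)) = 0)
    (z : A) (hz : Wd u v z) : τ z = 0 := by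
  have two : ∀ v : V, v + v = 0 → v = 0 := fun v h => by
    have : (2 : ℂ) • v = 0 := by rw [← h]; module
    simpa using this
  have hu' : ∀ t, u * (u * t) = 0 := fun t => by rw [← mul_assoc, hu, zero_mul]
  have hv' : ∀ t, v * (v * t) = 0 := fun t => by rw [← mul_assoc, hv, zero_mul]
  have c1 : ∀ n, u * (v * u) ^ n = (u * v) ^ n * u := fun n => by
    induction n with
    | zero => simp
    | succ n ih => rw [pow_succ, ← mul_assoc, ih, pow_succ]; simp only [mul_assoc]
  have c2 : ∀ n, v * (u * v) ^ n = (v * u) ^ n * v := fun n => by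
    induction n with
    | zero => simp
    | succ n ih => rw [pow_succ, ← mul_assoc, ih, pow_succ]; simp only [mul_assoc]
  have hp : ∀ n, (u + v) ^ (2 * n + 2) = (u * v) ^ (n + 1) + (v * u) ^ (n + 1) := fun n => by
    induction n with
    | zero => simp [pow_succ, mul_add, add_mul, hu, hv, add_comm]
    | succ n ih =>
      have h2 : (u + v) ^ 2 = u * v + v * u := by
        simp [pow_succ, mul_add, add_mul, hu, hv, add_comm]
      rw [show 2 * (n + 1) + 2 = (2 * n + 2) + 2 by ring, pow_add, ih, h2, add_mul, mul_add, mul_add,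
        ← pow_succ, ← pow_succ, pow_succ (u * v) n, pow_succ (v * u) n]
      simp only [mul_assoc, hu', hv', mul_zero, add_zero, zero_add]
  have huv : ∀ n, τ ((u * v) ^ (n + 1)) = 0 := fun n => by
    apply two
    have h := t (2 * n + 1)
    rw [hp, map_add] at h
    rw [← h]
    congr 1
    rw [pow_succ (u * v), ← mul_assoc, hτ, ← mul_assoc, c2, mul_assoc, ← pow_succ]
  have hvu : ∀ n, τ ((v * u) ^ (n + 1)) = 0 := fun n => by
    have h := t (2 * n + 1)
    rw [hp, map_add, huv, zero_add] at h
    exact h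
  have main : z = 0 ∨ ∃ n, z = (u * v) ^ (n + 1) ∨ z = (v * u) ^ (n + 1) ∨ z = u * (v * u) ^ n ∨
      z = v * (u * v) ^ n := by
    induction hz with
    | a => exact Or.inr ⟨0, by simp⟩
    | b => exact Or.inr ⟨0, by simp⟩
    | am w _ ih =>
      rcases ih with h | ⟨n, h | h | h | h⟩ <;> subst h
      · simp
      · left; rw [pow_succ', mul_assoc, hu']
      · right; exact ⟨n + 1, by simp⟩
      · left; rw [hu']
      · right; refine ⟨n, Or.inl ?_⟩; rw [pow_succ', mul_assoc]
    | bm w _ ih =>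
      rcases ih with h | ⟨n, h | h | h | h⟩ <;> subst h
      · simp
      · right; exact ⟨n + 1, by simp⟩
      · left; rw [pow_succ', mul_assoc, hv']
      · right; refine ⟨n, Or.inr (Or.inl ?_)⟩; rw [pow_succ', mul_assoc]
      · left; rw [hv']
  rcases main with h | ⟨n, h | h | h | h⟩ <;> subst h
  · simp
  · exact huv n
  · exact hvu n
  · cases n with
    | zero => simpa using tu
    | succ n => rw [hτ, pow_succ]; simp only [mul_assoc, hu, mul_zero, map_zero]
  · cases n with
    | zero => simpa using tv
    | succ n => rw [hτ, pow_succ]; simp only [mul_assoc, hv, mul_zero, map_zero]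
end Alg

set_option linter.unusedSimpArgs false
section Alg2

/-- abstract preprojective data in an algebra -/
structure PData (G : SimpleGraph K) (A : Type) [Ring A] [Algebra ℂ A] where
  E : K → A
  R : K → K → A
  s : K → K → ℂ
  hEE : ∀ i j, E i * E j = if i = j then E i else 0
  hE1 : ∑ i, E i = 1
  hER : ∀ i j, E j * R i j = R i j
  hRE : ∀ i j, R i j * E i = R i j
  hR0 : ∀ i j, ¬ G.Adj i j → R i j = 0
  hs : ∀ i j, G.Adj i j → s i j ≠ 0
  hrel : ∀ i, ∑ j, s j i • (R j i * R i j) = 0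
  hgen : ∀ M : Submodule ℂ A, 1 ∈ M → (∀ i, ∀ x ∈ M, E i * x ∈ M) →
    (∀ i j, ∀ x ∈ M, R i j * x ∈ M) → M = ⊤

/-- `v :: L` is a linear arm hanging off `u`. -/
def IsArm (G : SimpleGraph K) : K → K → List K → Prop
  | u, v, [] => u ≠ v ∧ ∀ w, G.Adj v w ↔ w = u
  | u, v, m :: L => u ≠ m ∧ u ∉ v :: m :: L ∧ (∀ w, G.Adj v w ↔ w = u ∨ w = m) ∧ IsArm G v m L

variable {G : SimpleGraph K} {A : Type} [Ring A] [Algebra ℂ A] (P : PData G A)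

namespace PData

theorem EE_self (i : K) : P.E i * P.E i = P.E i := by simp [P.hEE]

theorem EE_ne {i j : K} (h : i ≠ j) : P.E i * P.E j = 0 := by simp [P.hEE, h]

theorem RE_ne {i j k : K} (h : i ≠ k) : P.R i j * P.E k = 0 := by
  rw [← P.hRE, mul_assoc, P.EE_ne h, mul_zero]

theorem ER_ne {i j k : K} (h : k ≠ j) : P.E k * P.R i j = 0 := by
  rw [← P.hER, ← mul_assoc, P.EE_ne h, zero_mul]

theorem RR_ne {i j k l : K} (h : i ≠ l) : P.R i j * P.R k l = 0 := by
  rw [← P.hER k l, ← mul_assoc, P.RE_ne h, zero_mul]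

/-- generation from a given element -/
theorem gen_from (M : Submodule ℂ A) (z : A) (hz : z ∈ M)
    (h1 : ∀ i, ∀ x ∈ M, P.E i * x ∈ M) (h2 : ∀ i j, ∀ x ∈ M, P.R i j * x ∈ M) (y : A) : y * z ∈ M := by
  have := P.hgen (M.comap (LinearMap.mulRight ℂ z)) (by simpa using hz)
    (fun i x hx => by
      simp only [Submodule.mem_comap, LinearMap.mulRight_apply] at hx ⊢
      rw [mul_assoc]; exact h1 i _ hx)
    (fun i j x hx => by
      simp only [Submodule.mem_comap, LinearMap.mulRight_apply] at hx ⊢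
      rw [mul_assoc]; exact h2 i j _ hx)
  have hy : y ∈ M.comap (LinearMap.mulRight ℂ z) := by rw [this]; trivial
  simpa using hy

theorem rel_leaf {u v : K} (h : ∀ w, G.Adj v w ↔ w = u) : P.R u v * P.R v u = 0 := by
  have hr := P.hrel v
  rw [Finset.sum_eq_single u] at hr
  · have ha : G.Adj u v := ((h u).2 rfl).symm
    exact (smul_eq_zero.mp hr).resolve_left (P.hs _ _ ha)
  · intro b _ hb
    have : ¬ G.Adj v b := fun hh => hb ((h b).1 hh)
    rw [P.hR0 v b this]; simp
  · simp

theorem rel_two {u v m : K} (hum : u ≠ m) (h : ∀ w, G.Adj v w ↔ w = u ∨ w = m) :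
    P.s u v • (P.R u v * P.R v u) + P.s m v • (P.R m v * P.R v m) = 0 := by
  have hr := P.hrel v
  rw [← hr, ← Finset.sum_pair hum (f := fun j => P.s j v • (P.R j v * P.R v j))]
  apply Finset.sum_subset (Finset.subset_univ _)
  intro x _ hx
  have : ¬ G.Adj v x := fun hh => hx (by simpa using (h x).1 hh)
  rw [P.hR0 v x this]; simp

theorem rel_two' {u v m : K} (hum : u ≠ m) (h : ∀ w, G.Adj v w ↔ w = u ∨ w = m) :
    ∃ κ : ℂ, P.R m v * P.R v m = κ • (P.R u v * P.R v u) := by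
  have hr := P.rel_two hum h
  have ha : G.Adj m v := ((h m).2 (Or.inr rfl)).symm
  have hs := P.hs _ _ ha
  refine ⟨- ((P.s m v)⁻¹ * P.s u v), ?_⟩
  have h2 : P.s m v • (P.R m v * P.R v m) = - (P.s u v • (P.R u v * P.R v u)) := by
    rw [eq_neg_iff_add_eq_zero, add_comm]; exact hr
  rw [neg_smul, mul_smul, ← smul_neg, ← h2, smul_smul, inv_mul_cancel₀ hs, one_smul]

/-- structure of the paths into an arm -/
theorem arm_struct (L : List K) : ∀ u v : K, IsArm G u v L → ∃ D : Submodule ℂ A,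
    P.E v ∈ D ∧ (∀ d ∈ D, ∀ i, P.E i * d ∈ D) ∧
    (∀ d ∈ D, ∀ i, i ∉ v :: L → P.E i * d = 0) ∧
    (∀ d ∈ D, ∃ t : ℂ, P.E v * d = t • P.E v) ∧
    (∀ d ∈ D, ∀ i j, ∃ d1 ∈ D, ∃ t : ℂ, ∃ d2 ∈ D,
      P.R i j * d = d1 + t • P.R v u + d2 * (P.R u v * P.R v u)) := by
  induction L with
  | nil =>
    rintro u v ⟨huv, h⟩
    refine ⟨Submodule.span ℂ {P.E v}, Submodule.mem_span_singleton_self _, ?_, ?_, ?_, ?_⟩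
    all_goals
      intro d hd
      obtain ⟨t, rfl⟩ := Submodule.mem_span_singleton.mp hd
    · intro i
      rw [mul_smul_comm, P.hEE]
      split_ifs with hi
      · subst hi; exact hd
      · simp
    · intro i hi
      rw [mul_smul_comm, P.EE_ne (by simpa using hi), smul_zero]
    · exact ⟨t, by rw [mul_smul_comm, P.EE_self]⟩
    · intro i j
      refine ⟨0, zero_mem _, if i = v ∧ j = u then t else 0, 0, zero_mem _, ?_⟩
      rw [mul_smul_comm]
      by_cases hi : i = v
      · subst hi
        by_cases hj : j = u
        · subst hj; simp [P.hRE]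
        · rw [P.hR0 i j (fun hh => hj ((h j).1 hh))]; simp [hj]
      · rw [P.RE_ne hi]; simp [hi]
  | cons m L ih =>
    rintro u v ⟨hum, hu, h, harm⟩
    obtain ⟨D, hD1, hD2, hD3, hD4, hD5⟩ := ih v m harm
    have hv : v ∉ m :: L := by
      cases L with
      | nil => simpa using harm.1
      | cons m' L => exact harm.2.1
    obtain ⟨κ, hκ⟩ := P.rel_two' hum h
    let D' : Submodule ℂ A := Submodule.span ℂ {P.E v} ⊔ D.map (LinearMap.mulRight ℂ (P.R v m))
    have hE : P.E v ∈ D' := Submodule.mem_sup_left (Submodule.mem_span_singleton_self _)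
    have hDR : ∀ d ∈ D, d * P.R v m ∈ D' := fun d hd =>
      Submodule.mem_sup_right ⟨d, hd, rfl⟩
    have hdec : ∀ d ∈ D', ∃ t : ℂ, ∃ d' ∈ D, d = t • P.E v + d' * P.R v m := by
      intro d hd
      obtain ⟨x, hx, y, ⟨d', hd', rfl⟩, rfl⟩ := Submodule.mem_sup.mp hd
      obtain ⟨t, rfl⟩ := Submodule.mem_span_singleton.mp hx
      exact ⟨t, d', hd', rfl⟩
    refine ⟨D', hE, ?_, ?_, ?_, ?_⟩
    all_goals
      intro d hd
      obtain ⟨t, d', hd', rfl⟩ := hdec d hd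
    · intro i
      rw [mul_add, mul_smul_comm, P.hEE, ← mul_assoc]
      refine Submodule.add_mem _ (Submodule.smul_mem _ _ ?_) (hDR _ (hD2 _ hd' _))
      split_ifs with hi
      · subst hi; exact hE
      · simp
    · intro i hi
      rw [List.mem_cons, not_or] at hi
      rw [mul_add, mul_smul_comm, P.EE_ne hi.1, ← mul_assoc, hD3 _ hd' _ hi.2]; simp
    · exact ⟨t, by rw [mul_add, mul_smul_comm, P.EE_self, ← mul_assoc, hD3 _ hd' _ hv]; simp⟩
    · intro i j
      obtain ⟨d1, hd1, t', d2, hd2, he⟩ := hD5 d' hd' i j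
      have e2 : P.R i j * (d' * P.R v m) = d1 * P.R v m +
          ((t' * κ) • P.E v + κ • (d2 * P.R v m)) * (P.R u v * P.R v u) := by
        rw [← mul_assoc, he, add_mul, add_mul, smul_mul_assoc, hκ, mul_assoc d2,
          mul_assoc (P.R v m), hκ]
        simp only [add_mul, smul_mul_assoc, mul_smul_comm, smul_smul, ← mul_assoc, P.hER]
        rw [add_assoc]
      have m2 : (t' * κ) • P.E v + κ • (d2 * P.R v m) ∈ D' :=
        Submodule.add_mem _ (Submodule.smul_mem _ _ hE) (Submodule.smul_mem _ _ (hDR _ hd2))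
      by_cases hi : i = v
      · subst hi
        by_cases hj : j = u
        · subst hj
          refine ⟨d1 * P.R i m, hDR _ hd1, t, _, m2, ?_⟩
          rw [mul_add, mul_smul_comm, P.hRE, e2]; abel
        · by_cases hj' : j = m
          · subst hj'
            refine ⟨t • P.R i j + d1 * P.R i j, ?_, 0, _, m2, ?_⟩
            · refine Submodule.add_mem _ (Submodule.smul_mem _ _ ?_) (hDR _ hd1)
              rw [← P.hER]; exact hDR _ hD1
            · rw [mul_add, mul_smul_comm, P.hRE, e2, zero_smul]; abel
          · refine ⟨d1 * P.R i m, hDR _ hd1, 0, _, m2, ?_⟩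
            have : P.R i j * P.E i = 0 := by
              rw [P.hR0 i j (fun hh => by rcases (h j).1 hh with h | h <;> contradiction), zero_mul]
            rw [mul_add, mul_smul_comm, this, e2, zero_smul]; simp
      · refine ⟨d1 * P.R v m, hDR _ hd1, 0, _, m2, ?_⟩
        rw [mul_add, mul_smul_comm, P.RE_ne hi, e2, zero_smul]; simp

variable (N : Submodule ℂ A)

/-- the vertex `v` is good -/
def Good (v : K) : Prop := ∀ y, P.E v * y * P.E v ∈ N

theorem good_arm (hN : ∀ x y, x * y - y * x ∈ N) (hNE : ∀ i, P.E i ∈ N) {u v : K} {L : List K}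
    (h : IsArm G u v L) (hu : P.Good N u) : P.Good N v := by
  intro y
  obtain ⟨D, hD1, hD2, hD3, hD4, hD5⟩ := P.arm_struct L u v h
  let M : Submodule ℂ A := D ⊔ LinearMap.range (LinearMap.mulRight ℂ (P.R v u))
  have hr : ∀ y, y * P.R v u ∈ M := fun y => Submodule.mem_sup_right ⟨y, rfl⟩
  have hM : y * P.E v ∈ M := by
    apply P.gen_from M (P.E v) (Submodule.mem_sup_left hD1)
    · intro i x hx
      obtain ⟨d, hd, _, ⟨z, rfl⟩, rfl⟩ := Submodule.mem_sup.mp hx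
      rw [mul_add]
      refine Submodule.add_mem _ (Submodule.mem_sup_left (hD2 d hd i)) ?_
      rw [LinearMap.mulRight_apply, ← mul_assoc]; exact hr _
    · intro i j x hx
      obtain ⟨d, hd, _, ⟨z, rfl⟩, rfl⟩ := Submodule.mem_sup.mp hx
      rw [mul_add]
      refine Submodule.add_mem _ ?_ ?_
      · obtain ⟨d1, hd1, t, d2, hd2, he⟩ := hD5 d hd i j
        rw [he]
        refine Submodule.add_mem _ (Submodule.add_mem _ (Submodule.mem_sup_left hd1) ?_) ?_
        · rw [← one_mul (P.R v u), ← smul_mul_assoc]; exact hr _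
        · rw [← mul_assoc]; exact hr _
      · rw [LinearMap.mulRight_apply, ← mul_assoc]; exact hr _
  obtain ⟨d, hd, _, ⟨z, rfl⟩, he⟩ := Submodule.mem_sup.mp hM
  obtain ⟨t, ht⟩ := hD4 d hd
  rw [mul_assoc, ← he, mul_add, ht]
  refine Submodule.add_mem _ (Submodule.smul_mem _ _ (hNE v)) ?_
  rw [LinearMap.mulRight_apply, ← mul_assoc]
  have e : P.E v * z * P.R v u = (P.E v * z * P.R v u - P.R v u * (P.E v * z)) +
    ((P.E u * (P.R v u * (P.E v * z)) - (P.R v u * (P.E v * z)) * P.E u) +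
      (P.R v u * (P.E v * z)) * P.E u) := by
    rw [← mul_assoc (P.E u), P.hER]; abel
  rw [e]
  refine Submodule.add_mem _ (hN _ _) (Submodule.add_mem _ (hN _ _) ?_)
  have := hu (P.R v u * (P.E v * z))
  rw [← mul_assoc (P.E u), P.hER] at this
  exact this

theorem top_of_good (hN : ∀ x y, x * y - y * x ∈ N) (h : ∀ v, P.Good N v) : N = ⊤ := by
  rw [eq_top_iff]
  intro y _
  have : y = ∑ i, ∑ j, P.E i * y * P.E j := by
    simp_rw [← Finset.mul_sum, P.hE1, mul_one, ← Finset.sum_mul, P.hE1, one_mul]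
  rw [this]
  refine Submodule.sum_mem _ fun i _ => Submodule.sum_mem _ fun j _ => ?_
  by_cases hij : i = j
  · subst hij; exact h i y
  · have := hN (P.E i) (y * P.E j)
    rw [mul_assoc y, P.EE_ne (Ne.symm hij), mul_zero, sub_zero, ← mul_assoc] at this
    exact this

theorem center (c : K) (harm : ∀ n, G.Adj c n → ∃ L, IsArm G c n L ∧ c ∉ n :: L)
    (X : Submodule ℂ A) (hX1 : P.E c ∈ X) (hX2 : ∀ x ∈ X, P.E c * x = x)
    (hX3 : ∀ n, G.Adj c n → ∀ x ∈ X, P.R n c * P.R c n * x ∈ X) (y : A) :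
    P.E c * y * P.E c ∈ X := by
  have hD : ∀ n, G.Adj c n → ∃ D : Submodule ℂ A,
    P.E n ∈ D ∧ (∀ d ∈ D, ∀ i, P.E i * d ∈ D) ∧
    (∀ d ∈ D, P.E c * d = 0) ∧
    (∀ d ∈ D, ∀ i j, ∃ d1 ∈ D, ∃ t : ℂ, ∃ d2 ∈ D,
      P.R i j * d = d1 + t • P.R n c + d2 * (P.R c n * P.R n c)) := by
    intro n hn
    obtain ⟨L, hL, hc⟩ := harm n hn
    obtain ⟨D, h1, h2, h3, h4, h5⟩ := P.arm_struct L c n hL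
    exact ⟨D, h1, h2, fun d hd => h3 d hd c hc, h5⟩
  choose! D hD1 hD2 hD3 hD4 using hD
  let S : Set A := {z | ∃ n, G.Adj c n ∧ ∃ d ∈ D n, ∃ x ∈ X, z = d * P.R c n * x}
  let M : Submodule ℂ A := X ⊔ Submodule.span ℂ S
  have hS : ∀ n, G.Adj c n → ∀ d ∈ D n, ∀ x ∈ X, d * P.R c n * x ∈ M := fun n hn d hd x hx =>
    Submodule.mem_sup_right (Submodule.subset_span ⟨n, hn, d, hd, x, hx, rfl⟩)
  have ind : ∀ α : A, (∀ x ∈ X, α * x ∈ M) →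
      (∀ n, G.Adj c n → ∀ d ∈ D n, ∀ x ∈ X, α * (d * P.R c n * x) ∈ M) → ∀ x ∈ M, α * x ∈ M := by
    intro α h1 h2 x hx
    obtain ⟨x1, hx1, x2, hx2, rfl⟩ := Submodule.mem_sup.mp hx
    rw [mul_add]
    refine Submodule.add_mem _ (h1 _ hx1) ?_
    clear hx
    induction hx2 using Submodule.span_induction with
    | mem x h =>
      obtain ⟨n, hn, d, hd, x, hx, rfl⟩ := h
      exact h2 n hn d hd x hx
    | zero => simp
    | add x y _ _ hx hy => rw [mul_add]; exact Submodule.add_mem _ hx hy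
    | smul c x _ hx => rw [mul_smul_comm]; exact Submodule.smul_mem _ _ hx
  have hM : y * P.E c ∈ M := by
    apply P.gen_from M (P.E c) (Submodule.mem_sup_left hX1)
    · intro i
      apply ind
      · intro x hx
        rw [← hX2 x hx, ← mul_assoc, P.hEE]
        split_ifs with hi
        · subst hi; rw [hX2 x hx]; exact Submodule.mem_sup_left hx
        · simp
      · intro n hn d hd x hx
        rw [← mul_assoc, ← mul_assoc]
        exact hS n hn _ (hD2 n hn d hd i) x hx
    · intro i j
      apply ind
      · intro x hx
        rw [← hX2 x hx, ← mul_assoc]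
        by_cases hi : i = c
        · subst hi
          by_cases hj : G.Adj i j
          · rw [P.hRE, ← P.hER]; exact hS j hj _ (hD1 j hj) x hx
          · rw [P.hR0 _ _ hj]; simp
        · rw [P.RE_ne hi]; simp
      · intro n hn d hd x hx
        obtain ⟨d1, hd1, t, d2, hd2, he⟩ := hD4 n hn d hd i j
        have : P.R i j * (d * P.R c n * x) = d1 * P.R c n * x + t • (P.R n c * P.R c n * x) +
          d2 * P.R c n * (P.R n c * P.R c n * x) := by
          rw [← mul_assoc, ← mul_assoc, he]
          simp only [add_mul, smul_mul_assoc, mul_assoc]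
        rw [this]
        exact Submodule.add_mem _ (Submodule.add_mem _ (hS n hn _ hd1 x hx)
          (Submodule.smul_mem _ _ (Submodule.mem_sup_left (hX3 n hn x hx))))
          (hS n hn _ hd2 _ (hX3 n hn x hx))
  obtain ⟨x1, hx1, x2, hx2, he⟩ := Submodule.mem_sup.mp hM
  rw [mul_assoc, ← he, mul_add, hX2 _ hx1]
  refine Submodule.add_mem _ hx1 ?_
  have : P.E c * x2 = 0 := by
    clear he
    induction hx2 using Submodule.span_induction with
    | mem x h =>
      obtain ⟨n, hn, d, hd, x, hx, rfl⟩ := h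
      rw [← mul_assoc, ← mul_assoc, hD3 n hn d hd]; simp
    | zero => simp
    | add x y _ _ hx hy => rw [mul_add, hx, hy, add_zero]
    | smul c x _ hx => rw [mul_smul_comm, hx, smul_zero]
  rw [this]; exact zero_mem _

theorem pow_loop {u v : K} (k : ℕ) :
    (P.R v u * P.R u v) ^ (k + 1) = P.R v u * (P.R u v * P.R v u) ^ k * P.R u v := by
  induction k with
  | zero => simp
  | succ k ih => rw [pow_succ, ih, pow_succ]; simp only [mul_assoc]

theorem arm_nil (L : List K) : ∀ u v : K, IsArm G u v L →
    (P.R v u * P.R u v) ^ (L.length + 2) = 0 := by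
  induction L with
  | nil =>
    rintro u v ⟨_, h⟩
    rw [List.length_nil, zero_add, P.pow_loop, P.rel_leaf h]; simp
  | cons m L ih =>
    rintro u v ⟨hum, hu, h, harm⟩
    obtain ⟨κ, hκ⟩ := P.rel_two' (Ne.symm hum) (v := v) (fun w => (h w).trans or_comm)
    rw [P.pow_loop, hκ, smul_pow, List.length_cons, ih v m harm]; simp

theorem arm_trace (hN : ∀ x y, x * y - y * x ∈ N) (L : List K) : ∀ u v : K, IsArm G u v L →
    ∀ k, (P.R v u * P.R u v) ^ (k + 1) ∈ N := by
  have red : ∀ u v k, (P.R u v * P.R v u) ^ (k + 1) ∈ N → (P.R v u * P.R u v) ^ (k + 1) ∈ N := by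
    intro u v k h
    have := hN (P.R v u * (P.R u v * P.R v u) ^ k) (P.R u v)
    rw [← P.pow_loop, ← mul_assoc, ← pow_succ'] at this
    simpa using Submodule.add_mem _ this h
  induction L with
  | nil =>
    rintro u v ⟨_, h⟩ k
    apply red
    rw [P.rel_leaf h]; simp
  | cons m L ih =>
    rintro u v ⟨hum, hu, h, harm⟩ k
    apply red
    obtain ⟨κ, hκ⟩ := P.rel_two' (Ne.symm hum) (v := v) (fun w => (h w).trans or_comm)
    rw [hκ, smul_pow]
    exact Submodule.smul_mem _ _ (ih v m harm k)

end PData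
end Alg2

section Alg3
variable {G : SimpleGraph K} {A : Type} [Ring A] [Algebra ℂ A] (P : PData G A)

namespace PData
variable (N : Submodule ℂ A)

theorem center_good_y (hNE : ∀ i, P.E i ∈ N) (c : K)
    (harm : ∀ n, G.Adj c n → ∃ L, IsArm G c n L ∧ c ∉ n :: L)
    (y : A) (hy : P.E c * y = y) (hy' : y * P.E c = y) (hyN : ∀ k, y ^ (k + 1) ∈ N)
    (h : ∀ n, G.Adj c n → ∃ κ : ℂ, P.R n c * P.R c n = κ • y) : P.Good N c := by
  intro z
  have hX : Submodule.span ℂ {x | x = P.E c ∨ ∃ k : ℕ, x = y ^ (k + 1)} ≤ N := by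
    rw [Submodule.span_le]
    rintro x (rfl | ⟨k, rfl⟩)
    · exact hNE c
    · exact hyN k
  apply hX
  apply P.center c harm
  · exact Submodule.subset_span (Or.inl rfl)
  · intro x hx
    induction hx using Submodule.span_induction with
    | mem x hx =>
      obtain (rfl | ⟨k, rfl⟩) := hx
      · exact P.EE_self c
      · rw [pow_succ', ← mul_assoc, hy]
    | zero => simp
    | add x y _ _ hx hy => rw [mul_add, hx, hy]
    | smul t x _ hx => rw [mul_smul_comm, hx]
  · intro n hn x hx
    obtain ⟨κ, hκ⟩ := h n hn
    rw [hκ, smul_mul_assoc]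
    apply Submodule.smul_mem
    induction hx using Submodule.span_induction with
    | mem x hx =>
      obtain (rfl | ⟨k, rfl⟩) := hx
      · rw [hy']; exact Submodule.subset_span (Or.inr ⟨0, by simp⟩)
      · rw [← pow_succ']; exact Submodule.subset_span (Or.inr ⟨k + 1, rfl⟩)
    | zero => simp
    | add x y _ _ hx hy => rw [mul_add]; exact Submodule.add_mem _ hx hy
    | smul t x _ hx => rw [mul_smul_comm]; exact Submodule.smul_mem _ _ hx

theorem loop_E (c n : K) : P.E c * (P.R n c * P.R c n) = P.R n c * P.R c n := by
  rw [← mul_assoc, P.hER]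

theorem E_loop (c n : K) : (P.R n c * P.R c n) * P.E c = P.R n c * P.R c n := by
  rw [mul_assoc, P.hRE]

theorem center_good0 (hNE : ∀ i, P.E i ∈ N) (c : K) (h : ∀ n, ¬ G.Adj c n) : P.Good N c :=
  P.center_good_y N hNE c (fun n hn => absurd hn (h n)) 0 (by simp) (by simp) (by simp)
    (fun n hn => absurd hn (h n))

theorem center_good1 (hNE : ∀ i, P.E i ∈ N) (c : K)
    (harm : ∀ n, G.Adj c n → ∃ L, IsArm G c n L ∧ c ∉ n :: L) (n : K)
    (h : ∀ w, G.Adj c w ↔ w = n) : P.Good N c :=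
  P.center_good_y N hNE c harm 0 (by simp) (by simp) (by simp)
    (fun m hm => ⟨0, by rw [(h m).1 hm, P.rel_leaf h]; simp⟩)

theorem center_good2 (hN : ∀ x y, x * y - y * x ∈ N) (hNE : ∀ i, P.E i ∈ N) (c : K)
    (harm : ∀ n, G.Adj c n → ∃ L, IsArm G c n L ∧ c ∉ n :: L) (n m : K) (hnm : n ≠ m)
    (h : ∀ w, G.Adj c w ↔ w = n ∨ w = m) : P.Good N c := by
  obtain ⟨L, hL, -⟩ := harm n ((h n).2 (Or.inl rfl))
  refine P.center_good_y N hNE c harm (P.R n c * P.R c n) (P.loop_E c n) (P.E_loop c n)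
    (P.arm_trace N hN L c n hL) ?_
  intro w hw
  rcases (h w).1 hw with rfl | rfl
  · exact ⟨1, by simp⟩
  · exact P.rel_two' hnm h

theorem center_good3 (hN : ∀ x y, x * y - y * x ∈ N) (hNE : ∀ i, P.E i ∈ N) (c : K)
    (harm : ∀ n, G.Adj c n → ∃ L, IsArm G c n L ∧ c ∉ n :: L) (n₁ n₂ n₃ : K)
    (h12 : n₁ ≠ n₂) (h13 : n₁ ≠ n₃) (h23 : n₂ ≠ n₃)
    (h : ∀ w, G.Adj c w ↔ w = n₁ ∨ w = n₂ ∨ w = n₃)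
    (L₁ L₂ L₃ : List K) (a₁ : IsArm G c n₁ L₁) (a₂ : IsArm G c n₂ L₂) (a₃ : IsArm G c n₃ L₃)
    (hl₁ : L₁.length = 0) (hl : L₂.length = 0 ∨ (L₂.length = 1 ∧ L₃.length ≤ 3)) :
    P.Good N c := by
  obtain ⟨u, hu⟩ : ∃ u, u = P.s n₁ c • (P.R n₁ c * P.R c n₁) := ⟨_, rfl⟩
  obtain ⟨x, hx⟩ : ∃ u, u = P.s n₂ c • (P.R n₂ c * P.R c n₂) := ⟨_, rfl⟩
  obtain ⟨y, hy⟩ : ∃ u, u = P.s n₃ c • (P.R n₃ c * P.R c n₃) := ⟨_, rfl⟩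
  have hsum : u + x + y = 0 := by
    have hr := P.hrel c
    rw [hu, hx, hy, ← hr, add_assoc]
    have : ({n₁, n₂, n₃} : Finset K).sum (fun j => P.s j c • (P.R j c * P.R c j)) =
      ∑ j, P.s j c • (P.R j c * P.R c j) := by
      apply Finset.sum_subset (Finset.subset_univ _)
      intro w _ hw
      have : ¬ G.Adj c w := fun hh => hw (by simpa using (h w).1 hh)
      rw [P.hR0 c w this]; simp
    rw [← this, Finset.sum_insert (by simp [h12, h13]), Finset.sum_pair h23]
  have hyu : u + x = -y := eq_neg_of_add_eq_zero_left hsum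
  have Eu : P.E c * u = u := by rw [hu, mul_smul_comm, P.loop_E]
  have Ex : P.E c * x = x := by rw [hx, mul_smul_comm, P.loop_E]
  have uE : u * P.E c = u := by rw [hu, smul_mul_assoc, P.E_loop]
  have xE : x * P.E c = x := by rw [hx, smul_mul_assoc, P.E_loop]
  have tru : ∀ k, u ^ (k + 1) ∈ N := fun k => by
    rw [hu, smul_pow]; exact Submodule.smul_mem _ _ (P.arm_trace N hN L₁ c n₁ a₁ k)
  have trx : ∀ k, x ^ (k + 1) ∈ N := fun k => by
    rw [hx, smul_pow]; exact Submodule.smul_mem _ _ (P.arm_trace N hN L₂ c n₂ a₂ k)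
  have try' : ∀ k, (u + x) ^ (k + 1) ∈ N := fun k => by
    rw [hyu, ← neg_one_smul ℂ, smul_pow, hy, smul_pow]
    exact Submodule.smul_mem _ _ (Submodule.smul_mem _ _ (P.arm_trace N hN L₃ c n₃ a₃ k))
  have nu : u ^ (L₁.length + 2) = 0 := by rw [hu, smul_pow, P.arm_nil L₁ c n₁ a₁, smul_zero]
  have nx : x ^ (L₂.length + 2) = 0 := by rw [hx, smul_pow, P.arm_nil L₂ c n₂ a₂, smul_zero]
  have ny : (u + x) ^ (L₃.length + 2) = 0 := by
    rw [hyu, neg_pow, hy, smul_pow, P.arm_nil L₃ c n₃ a₃, smul_zero, mul_zero]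
  have nu2 : u * u = 0 := by rw [← pow_two]; simpa [hl₁] using nu
  have key : ∀ z, Wd u x z → z ∈ N := by
    intro z hz
    have hτ : ∀ x y, N.mkQ (x * y) = N.mkQ (y * x) := fun x y => by
      rw [Submodule.mkQ_apply, Submodule.mkQ_apply]; exact (Submodule.Quotient.eq N).2 (hN x y)
    have e : ∀ w, w ∈ N → N.mkQ w = 0 := fun w hw => by simpa using hw
    have := fun k => e _ (tru k)
    suffices N.mkQ z = 0 by simpa using this
    rcases hl with hl | ⟨hl, hl3⟩
    · exact d_trace u x N.mkQ hτ nu2 (by rw [← pow_two]; simpa [hl] using nx)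
        (e _ (by simpa using tru 0)) (e _ (by simpa using trx 0)) (fun k => e _ (try' k)) z hz
    · exact e8_trace u x N.mkQ hτ nu2
        (by have : x ^ 3 = 0 := by simpa [hl] using nx
            rw [← this]; noncomm_ring)
        (pow_eq_zero_of_le (by omega) ny)
        (e _ (by simpa using tru 0)) (e _ (by simpa using trx 0))
        (e _ (by simpa [pow_two] using trx 1)) (e _ (try' 1)) (e _ (try' 2)) (e _ (try' 3)) z hz
  intro z
  have hX : Submodule.span ℂ {w | w = P.E c ∨ Wd u x w} ≤ N := by
    rw [Submodule.span_le]
    rintro x (rfl | hx)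
    · exact hNE c
    · exact key _ hx
  apply hX
  have su : ∀ w ∈ Submodule.span ℂ {w | w = P.E c ∨ Wd u x w},
      u * w ∈ Submodule.span ℂ {w | w = P.E c ∨ Wd u x w} := by
    intro w hw
    induction hw using Submodule.span_induction with
    | mem w hx =>
      obtain (rfl | hx) := hx
      · rw [uE]; exact Submodule.subset_span (Or.inr Wd.a)
      · exact Submodule.subset_span (Or.inr (Wd.am _ hx))
    | zero => simp
    | add x y _ _ hx hy => rw [mul_add]; exact Submodule.add_mem _ hx hy
    | smul t x _ hx => rw [mul_smul_comm]; exact Submodule.smul_mem _ _ hx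
  have sx : ∀ w ∈ Submodule.span ℂ {w | w = P.E c ∨ Wd u x w},
      x * w ∈ Submodule.span ℂ {w | w = P.E c ∨ Wd u x w} := by
    intro w hw
    induction hw using Submodule.span_induction with
    | mem w hx =>
      obtain (rfl | hx) := hx
      · rw [xE]; exact Submodule.subset_span (Or.inr Wd.b)
      · exact Submodule.subset_span (Or.inr (Wd.bm _ hx))
    | zero => simp
    | add x y _ _ hx hy => rw [mul_add]; exact Submodule.add_mem _ hx hy
    | smul t x _ hx => rw [mul_smul_comm]; exact Submodule.smul_mem _ _ hx
  apply P.center c harm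
  · exact Submodule.subset_span (Or.inl rfl)
  · intro w hw
    induction hw using Submodule.span_induction with
    | mem w hx =>
      obtain (rfl | hx) := hx
      · exact P.EE_self c
      · cases hx with
        | a => exact Eu
        | b => exact Ex
        | am w _ => rw [← mul_assoc, Eu]
        | bm w _ => rw [← mul_assoc, Ex]
    | zero => simp
    | add x y _ _ hx hy => rw [mul_add, hx, hy]
    | smul t x _ hx => rw [mul_smul_comm, hx]
  · intro n hn w hw
    have inv : ∀ n, G.Adj c n →
        P.R n c * P.R c n = (P.s n c)⁻¹ • (P.s n c • (P.R n c * P.R c n)) := fun n hn => by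
      rw [smul_smul, inv_mul_cancel₀ (P.hs _ _ hn.symm), one_smul]
    rw [inv n hn, smul_mul_assoc]
    apply Submodule.smul_mem
    rcases (h n).1 hn with rfl | rfl | rfl
    · rw [← hu]; exact su w hw
    · rw [← hx]; exact sx w hw
    · rw [← hy, show y = -(u + x) by rw [hyu, neg_neg], neg_mul, add_mul]
      exact Submodule.neg_mem _ (Submodule.add_mem _ (su w hw) (sx w hw))

end PData
end Alg3

section Gr
variable (G : SimpleGraph K) [DecidableRel G.Adj]
    (hG : ((2 : ℝ) • (1 : Matrix K K ℝ) - G.adjMatrix ℝ).PosDef)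
include hG

theorem obs (f : K → ℝ) (hf : ∀ v, 0 ≤ f v) (hne : ∃ v, 0 < f v)
    (h : ∀ v, 2 * f v ≤ ∑ w ∈ G.neighborFinset v, f w) : False := by
  have hne' : f ≠ 0 := by
    rintro rfl
    obtain ⟨v, hv⟩ := hne
    simp at hv
  have := hG.dotProduct_mulVec_pos hne'
  refine absurd this (not_lt.2 ?_)
  unfold dotProduct
  apply Finset.sum_nonpos
  intro v _
  rw [Matrix.sub_mulVec, Matrix.smul_mulVec, Matrix.one_mulVec]
  simp only [Pi.star_apply, star_trivial, Pi.sub_apply, Pi.smul_apply, smul_eq_mul,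
    SimpleGraph.adjMatrix_mulVec_apply]
  exact mul_nonpos_of_nonneg_of_nonpos (hf v) (by linarith [h v])

theorem obsS (S : Finset K) (hS : S.Nonempty)
    (h : ∀ v ∈ S, 4 ≤ (G.neighborFinset v).card + (G.neighborFinset v ∩ S).card) : False := by
  classical
  let f : K → ℝ := fun v => if v ∈ S then 2 else if ∃ w ∈ S, G.Adj v w then 1 else 0
  have f0 : ∀ v, 0 ≤ f v := by
    intro v; simp only [f]; split_ifs <;> norm_num
  apply obs G hG f f0
  · obtain ⟨v, hv⟩ := hS
    exact ⟨v, by simp [f, hv]⟩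
  · intro v
    by_cases hv : v ∈ S
    · have h1 : ∑ w ∈ G.neighborFinset v, f w =
          ∑ w ∈ G.neighborFinset v, ((1 : ℝ) + if w ∈ S then 1 else 0) := by
        apply Finset.sum_congr rfl
        intro w hw
        have hw' : G.Adj v w := by simpa using hw
        by_cases hwS : w ∈ S
        · simp only [f, hwS, if_true]; norm_num
        · simp only [f, hwS, if_false]
          rw [if_pos ⟨v, hv, hw'.symm⟩]; norm_num
      rw [h1, Finset.sum_add_distrib, Finset.sum_ite_mem]
      simp only [f, hv, if_true, Finset.sum_const, nsmul_eq_mul, mul_one]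
      have := h v hv
      have h2 : (4 : ℝ) ≤ (G.neighborFinset v).card + (G.neighborFinset v ∩ S).card := by
        exact_mod_cast this
      linarith
    · by_cases hv2 : ∃ w ∈ S, G.Adj v w
      · obtain ⟨w, hw, hvw⟩ := hv2
        have : f w ≤ ∑ w ∈ G.neighborFinset v, f w :=
          Finset.single_le_sum (fun i _ => f0 i) (by simpa using hvw)
        have e1 : f w = 2 := by simp [f, hw]
        have e2 : f v = 1 := by
          simp only [f, hv, if_false]; rw [if_pos ⟨w, hw, hvw⟩]
        linarith
      · have e2 : f v = 0 := by simp only [f, hv, if_false, hv2]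
        rw [e2, mul_zero]
        exact Finset.sum_nonneg (fun i _ => f0 i)

/-- pushforward obstruction along a locally injective map -/
theorem obsP {I : Type} [Fintype I] [DecidableEq I] (φ : I → K) (nb : I → List I) (f : I → ℝ)
    (f0 : ∀ x, 0 ≤ f x) (hne : ∃ x, 0 < f x)
    (hsymm : ∀ x y, y ∈ nb x → x ∈ nb y)
    (hnd : ∀ x, ((nb x).map φ).Nodup)
    (hadj : ∀ x, ∀ y ∈ nb x, G.Adj (φ x) (φ y))
    (hf : ∀ x, 2 * f x ≤ ((nb x).map f).sum) : False := by
  classical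
  apply obs G hG (fun v => ∑ x, if φ x = v then f x else 0)
  · intro v
    exact Finset.sum_nonneg (fun x _ => by split_ifs; exacts [f0 x, le_rfl])
  · obtain ⟨x, hx⟩ := hne
    refine ⟨φ x, lt_of_lt_of_le hx ?_⟩
    have := Finset.single_le_sum (f := fun y => if φ y = φ x then f y else 0)
      (fun y _ => by split_ifs; exacts [f0 y, le_rfl]) (Finset.mem_univ x)
    simpa using this
  · intro v
    have hsum : ∀ x, ((nb x).map f).sum = ∑ y, if y ∈ nb x then f y else 0 := by
      intro x
      rw [← List.sum_toFinset f (hnd x).of_map, ← Finset.sum_filter]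
      congr 1; ext y; simp
    calc 2 * ∑ x, (if φ x = v then f x else 0)
        = ∑ x, if φ x = v then 2 * f x else 0 := by
          rw [Finset.mul_sum]; simp only [mul_ite, mul_zero]
      _ ≤ ∑ x, if φ x = v then ∑ y, (if y ∈ nb x then f y else 0) else 0 := by
          apply Finset.sum_le_sum
          intro x _
          split_ifs
          · rw [← hsum]; exact hf x
          · exact le_rfl
      _ = ∑ y, ∑ x, if φ x = v then (if y ∈ nb x then f y else 0) else 0 := by
          rw [Finset.sum_comm]
          apply Finset.sum_congr rfl; intro x _
          split_ifs <;> simp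
      _ ≤ ∑ y, if G.Adj v (φ y) then f y else 0 := by
          apply Finset.sum_le_sum
          intro y _
          by_cases hex : ∃ x, φ x = v ∧ y ∈ nb x
          · obtain ⟨x, hx, hy⟩ := hex
            rw [Finset.sum_eq_single x, if_pos hx, if_pos hy, if_pos (hx ▸ hadj x y hy)]
            · intro x' _ hx'
              split_ifs with h1 h2
              · exact absurd (List.inj_on_of_nodup_map (hnd y) (hsymm _ _ h2) (hsymm _ _ hy)
                  (h1.trans hx.symm)) hx'
              · rfl
              · rfl
            · simp
          · rw [Finset.sum_eq_zero]
            · split_ifs; exacts [f0 y, le_rfl]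
            · intro x _
              split_ifs with h1 h2
              · exact absurd ⟨x, h1, h2⟩ hex
              · rfl
              · rfl
      _ = ∑ w ∈ G.neighborFinset v, ∑ y, if φ y = w then f y else 0 := by
          rw [Finset.sum_comm]
          apply Finset.sum_congr rfl; intro y _
          rw [Finset.sum_ite_eq]; simp

theorem acyc : G.IsAcyclic := by
  intro u p hp
  apply obsS G hG p.support.toFinset ⟨u, by simp⟩
  intro v hv
  have h2 := hp.ncard_neighborSet_toSubgraph_eq_two (by simpa using hv)
  obtain ⟨x, y, hxy, hs⟩ := Set.ncard_eq_two.1 h2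
  have hx : p.toSubgraph.Adj v x := by
    show x ∈ p.toSubgraph.neighborSet v
    rw [hs]; simp
  have hy : p.toSubgraph.Adj v y := by
    show y ∈ p.toSubgraph.neighborSet v
    rw [hs]; simp
  have hsub : ({x, y} : Finset K) ⊆ G.neighborFinset v ∩ p.support.toFinset := by
    intro z hz
    simp only [Finset.mem_insert, Finset.mem_singleton] at hz
    rcases hz with rfl | rfl
    · simpa using ⟨hx.adj_sub, (p.mem_verts_toSubgraph).1 hx.snd_mem⟩
    · simpa using ⟨hy.adj_sub, (p.mem_verts_toSubgraph).1 hy.snd_mem⟩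
  have h3 := Finset.card_le_card hsub
  have h4 := Finset.card_le_card (Finset.inter_subset_left (s₁ := G.neighborFinset v)
    (s₂ := p.support.toFinset))
  rw [Finset.card_pair hxy] at h3
  omega

theorem deg_le (c : K) : (G.neighborFinset c).card ≤ 3 := by
  by_contra h
  apply obsS G hG {c} (by simp)
  intro v hv
  rw [Finset.mem_singleton] at hv
  subst hv
  omega

theorem unique_branch (a b : K) (hab : a ≠ b) (hr : G.Reachable a b)
    (ha : 3 ≤ (G.neighborFinset a).card) (hb : 3 ≤ (G.neighborFinset b).card) : False := by
  obtain ⟨p, hp⟩ := hr.exists_isPath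
  apply obsS G hG p.support.toFinset ⟨a, by simp⟩
  have hnil : ¬ p.Nil := fun h => hab h.eq
  have one : ∀ v x, p.toSubgraph.Adj v x → x ∈ G.neighborFinset v ∩ p.support.toFinset := by
    intro v x hx
    simpa using ⟨hx.adj_sub, (p.mem_verts_toSubgraph).1 hx.snd_mem⟩
  intro v hv
  rw [List.mem_toFinset, SimpleGraph.Walk.mem_support_iff_exists_getVert] at hv
  obtain ⟨i, rfl, hi⟩ := hv
  by_cases hi0 : i = 0
  · subst hi0
    rw [p.getVert_zero]
    have : p.snd ∈ G.neighborFinset a ∩ p.support.toFinset := one _ _ (p.toSubgraph_adj_snd hnil)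
    have := Finset.card_pos.2 ⟨_, this⟩
    omega
  by_cases hil : i = p.length
  · subst hil
    rw [p.getVert_length]
    have : p.penultimate ∈ G.neighborFinset b ∩ p.support.toFinset := by
      apply one
      show _ ∈ p.toSubgraph.neighborSet b
      rw [hp.neighborSet_toSubgraph_endpoint hnil]; simp
    have := Finset.card_pos.2 ⟨_, this⟩
    omega
  have h2 := hp.ncard_neighborSet_toSubgraph_internal_eq_two hi0 (by omega)
  obtain ⟨x, y, hxy, hs⟩ := Set.ncard_eq_two.1 h2
  have hsub : ({x, y} : Finset K) ⊆ G.neighborFinset (p.getVert i) ∩ p.support.toFinset := by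
    intro z hz
    apply one
    show z ∈ p.toSubgraph.neighborSet _
    rw [hs]; simpa using hz
  have h3 := Finset.card_le_card hsub
  have h4 := Finset.card_le_card (Finset.inter_subset_left (s₁ := G.neighborFinset (p.getVert i))
    (s₂ := p.support.toFinset))
  rw [Finset.card_pair hxy] at h3
  omega

omit hG in
theorem parent_unique (hac : G.IsAcyclic) {c u u' v : K} (hu : G.Adj u v) (hu' : G.Adj u' v)
    (hr : G.Reachable c v) (d : G.dist c v = G.dist c u + 1) (d' : G.dist c v = G.dist c u' + 1) :
    u = u' := by
  obtain ⟨p, hp, hp'⟩ := (hr.trans hu.symm.reachable).exists_path_of_dist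
  obtain ⟨q, hq, hq'⟩ := (hr.trans hu'.symm.reachable).exists_path_of_dist
  have h1 := (p.concat hu).isPath_of_length_eq_dist (by simp [hp', d])
  have h2 := (q.concat hu').isPath_of_length_eq_dist (by simp [hq', d'])
  have := (hac.subsingleton_path c v).elim ⟨_, h1⟩ ⟨_, h2⟩
  have := congrArg (fun w => w.1.penultimate) this
  simpa using this

omit hG in
theorem arm_exists (hac : G.IsAcyclic) (c : K)
    (hdeg : ∀ w, G.Reachable c w → w ≠ c → (G.neighborFinset w).card ≤ 2) (k : ℕ) :
    ∀ u v, G.Reachable c v → G.Adj u v → G.dist c v = G.dist c u + 1 →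
      Fintype.card K ≤ G.dist c v + k →
      ∃ L, IsArm G u v L ∧ ∀ w ∈ v :: L, G.dist c v ≤ G.dist c w := by
  induction k with
  | zero =>
    intro u v hr huv hd hk
    obtain ⟨p, hp, hp'⟩ := hr.exists_path_of_dist
    have := hp.length_lt
    omega
  | succ k ih =>
    intro u v hr huv hd hk
    have hvc : v ≠ c := by
      rintro rfl
      simp at hd
    by_cases hm : ∃ m, G.Adj v m ∧ m ≠ u
    · obtain ⟨m, hvm, hmu⟩ := hm
      have hdm : G.dist c m = G.dist c v + 1 := by
        rcases hac.dist_eq_dist_add_one_of_adj_of_reachable c hvm hr with h | h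
        · exact absurd (parent_unique G hac hvm.symm huv hr h hd) hmu
        · exact h
      obtain ⟨L, hL, hLd⟩ := ih v m (hr.trans hvm.reachable) hvm hdm (by omega)
      refine ⟨m :: L, ⟨hmu.symm, ?_, ?_, hL⟩, ?_⟩
      · intro hmem
        rcases List.mem_cons.1 hmem with rfl | hmem
        · exact huv.ne rfl
        · have := hLd _ hmem
          omega
      · intro w
        constructor
        · intro hw
          by_contra hcon
          push Not at hcon
          have h3 : ({u, m, w} : Finset K) ⊆ G.neighborFinset v := by
            intro z hz
            simp only [Finset.mem_insert, Finset.mem_singleton] at hz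
            rcases hz with rfl | rfl | rfl
            · simpa using huv.symm
            · simpa using hvm
            · simpa using hw
          have h4 := Finset.card_le_card h3
          rw [Finset.card_insert_of_notMem (by simp [hmu.symm, hcon.1.symm]),
            Finset.card_pair hcon.2.symm] at h4
          have := hdeg v hr hvc
          omega
        · rintro (rfl | rfl)
          · exact huv.symm
          · exact hvm
      · intro w hw
        rcases List.mem_cons.1 hw with rfl | hw
        · exact le_rfl
        · have := hLd _ hw
          omega
    · push Not at hm
      refine ⟨[], ⟨huv.ne, fun w => ⟨fun hw => hm w hw, ?_⟩⟩, by simp⟩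
      rintro rfl
      exact huv.symm

end Gr

section Gr2
variable (G : SimpleGraph K) [DecidableRel G.Adj]

theorem len_arith (a b c : ℕ) (e6 : 1 ≤ a → 1 ≤ b → 1 ≤ c → False)
    (e7a : 2 ≤ a → 2 ≤ b → False) (e7b : 2 ≤ a → 2 ≤ c → False) (e7c : 2 ≤ b → 2 ≤ c → False)
    (e8a : 1 ≤ a → 4 ≤ b → False) (e8b : 1 ≤ a → 4 ≤ c → False) (e8c : 1 ≤ b → 4 ≤ c → False)
    (e8d : 1 ≤ b → 4 ≤ a → False) (e8e : 1 ≤ c → 4 ≤ a → False) (e8f : 1 ≤ c → 4 ≤ b → False) :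
    (a = 0 ∧ (b = 0 ∨ (b = 1 ∧ c ≤ 3))) ∨ (a = 0 ∧ (c = 0 ∨ (c = 1 ∧ b ≤ 3))) ∨
    (b = 0 ∧ (a = 0 ∨ (a = 1 ∧ c ≤ 3))) ∨ (b = 0 ∧ (c = 0 ∨ (c = 1 ∧ a ≤ 3))) ∨
    (c = 0 ∧ (a = 0 ∨ (a = 1 ∧ b ≤ 3))) ∨ (c = 0 ∧ (b = 0 ∨ (b = 1 ∧ a ≤ 3))) := by
  have e6' : ¬ (1 ≤ a ∧ 1 ≤ b ∧ 1 ≤ c) := fun h => e6 h.1 h.2.1 h.2.2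
  have e7a' : ¬ (2 ≤ a ∧ 2 ≤ b) := fun h => e7a h.1 h.2
  have e7b' : ¬ (2 ≤ a ∧ 2 ≤ c) := fun h => e7b h.1 h.2
  have e7c' : ¬ (2 ≤ b ∧ 2 ≤ c) := fun h => e7c h.1 h.2
  have e8a' : ¬ (1 ≤ a ∧ 4 ≤ b) := fun h => e8a h.1 h.2
  have e8b' : ¬ (1 ≤ a ∧ 4 ≤ c) := fun h => e8b h.1 h.2
  have e8c' : ¬ (1 ≤ b ∧ 4 ≤ c) := fun h => e8c h.1 h.2
  have e8d' : ¬ (1 ≤ b ∧ 4 ≤ a) := fun h => e8d h.1 h.2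
  have e8e' : ¬ (1 ≤ c ∧ 4 ≤ a) := fun h => e8e h.1 h.2
  have e8f' : ¬ (1 ≤ c ∧ 4 ≤ b) := fun h => e8f h.1 h.2
  clear e6 e7a e7b e7c e8a e8b e8c e8d e8e e8f
  rcases Nat.eq_zero_or_pos a with h | h <;> rcases Nat.eq_zero_or_pos b with h' | h' <;>
    rcases Nat.eq_zero_or_pos c with h'' | h'' <;> omega

theorem or_perm1 {p q r : Prop} : p ∨ q ∨ r ↔ p ∨ r ∨ q := by tauto
theorem or_perm2 {p q r : Prop} : p ∨ q ∨ r ↔ q ∨ p ∨ r := by tauto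
theorem or_perm3 {p q r : Prop} : p ∨ q ∨ r ↔ q ∨ r ∨ p := by tauto
theorem or_perm4 {p q r : Prop} : p ∨ q ∨ r ↔ r ∨ p ∨ q := by tauto
theorem or_perm5 {p q r : Prop} : p ∨ q ∨ r ↔ r ∨ q ∨ p := by tauto

theorem arm_unpack {u v m : K} {L : List K} (h : IsArm G u v (m :: L)) :
    u ≠ m ∧ G.Adj v u ∧ G.Adj v m ∧ IsArm G v m L :=
  ⟨h.1, (h.2.2.1 u).2 (Or.inl rfl), (h.2.2.1 m).2 (Or.inr rfl), h.2.2.2⟩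

variable (hG : ((2 : ℝ) • (1 : Matrix K K ℝ) - G.adjMatrix ℝ).PosDef)
include hG

theorem exclE6 {c n₁ n₂ n₃ : K} (h12 : n₁ ≠ n₂) (h13 : n₁ ≠ n₃) (h23 : n₂ ≠ n₃)
    (b₁ : G.Adj c n₁) (b₂ : G.Adj c n₂) (b₃ : G.Adj c n₃) {L₁ L₂ L₃ : List K}
    (a₁ : IsArm G c n₁ L₁) (a₂ : IsArm G c n₂ L₂) (a₃ : IsArm G c n₃ L₃)
    (l₁ : 1 ≤ L₁.length) (l₂ : 1 ≤ L₂.length) (l₃ : 1 ≤ L₃.length) : False := by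
  match L₁, l₁, L₂, l₂, L₃, l₃ with
  | m₁ :: _, _, m₂ :: _, _, m₃ :: _, _ =>
    obtain ⟨p1, p2, p3, -⟩ := arm_unpack G a₁
    obtain ⟨q1, q2, q3, -⟩ := arm_unpack G a₂
    obtain ⟨r1, r2, r3, -⟩ := arm_unpack G a₃
    refine obsP G hG (I := Fin 7) ![c, n₁, m₁, n₂, m₂, n₃, m₃]
      ![[1, 3, 5], [0, 2], [1], [0, 4], [3], [0, 6], [5]] ![3, 2, 1, 2, 1, 2, 1] ?_ ⟨0, ?_⟩ ?_ ?_ ?_ ?_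
    · intro x; fin_cases x <;> simp
    · simp
    · decide
    · intro x; fin_cases x <;> simp [*]
    · intro x; fin_cases x <;> simp [*, SimpleGraph.adj_comm]
    · intro x; fin_cases x <;> simp <;> norm_num

theorem exclE7 {c n₁ n₂ n₃ : K} (h12 : n₁ ≠ n₂) (h13 : n₁ ≠ n₃) (h23 : n₂ ≠ n₃)
    (b₁ : G.Adj c n₁) (b₂ : G.Adj c n₂) (b₃ : G.Adj c n₃) {L₁ L₂ : List K}
    (a₁ : IsArm G c n₁ L₁) (a₂ : IsArm G c n₂ L₂)
    (l₁ : 2 ≤ L₁.length) (l₂ : 2 ≤ L₂.length) : False := by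
  match L₁, l₁, L₂, l₂ with
  | m₁ :: k₁ :: _, _, m₂ :: k₂ :: _, _ =>
    obtain ⟨p1, p2, p3, a₁⟩ := arm_unpack G a₁
    obtain ⟨q1, q2, q3, a₂⟩ := arm_unpack G a₂
    obtain ⟨r1, r2, r3, -⟩ := arm_unpack G a₁
    obtain ⟨s1, s2, s3, -⟩ := arm_unpack G a₂
    have b₃' := b₃.symm
    have r3' := r3.symm
    have s3' := s3.symm
    refine obsP G hG (I := Fin 8) ![c, n₃, n₁, m₁, k₁, n₂, m₂, k₂]
      ![[1, 2, 5], [0], [0, 3], [2, 4], [3], [0, 6], [5, 7], [6]] ![4, 2, 3, 2, 1, 3, 2, 1]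
      ?_ ⟨0, ?_⟩ ?_ ?_ ?_ ?_
    · intro x; fin_cases x <;> simp
    · simp
    · decide
    · intro x; fin_cases x <;> simp [*, h13.symm, h23.symm]
    · intro x; fin_cases x <;> simp [*]
    · intro x; fin_cases x <;> simp <;> norm_num

theorem exclE8 {c n₁ n₂ n₃ : K} (h12 : n₁ ≠ n₂) (h13 : n₁ ≠ n₃) (h23 : n₂ ≠ n₃)
    (b₁ : G.Adj c n₁) (b₂ : G.Adj c n₂) (b₃ : G.Adj c n₃) {L₁ L₂ : List K}
    (a₁ : IsArm G c n₁ L₁) (a₂ : IsArm G c n₂ L₂)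
    (l₁ : 1 ≤ L₁.length) (l₂ : 4 ≤ L₂.length) : False := by
  match L₁, l₁, L₂, l₂ with
  | m₁ :: _, _, m₂ :: k₂ :: x₂ :: y₂ :: _, _ =>
    obtain ⟨p1, p2, p3, -⟩ := arm_unpack G a₁
    obtain ⟨q1, q2, q3, a₂⟩ := arm_unpack G a₂
    obtain ⟨r1, r2, r3, a₂⟩ := arm_unpack G a₂
    obtain ⟨s1, s2, s3, a₂⟩ := arm_unpack G a₂
    obtain ⟨t1, t2, t3, -⟩ := arm_unpack G a₂
    have b₃' := b₃.symm
    have p3' := p3.symm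
    have t3' := t3.symm
    refine obsP G hG (I := Fin 9) ![c, n₃, n₁, m₁, n₂, m₂, k₂, x₂, y₂]
      ![[1, 2, 4], [0], [0, 3], [2], [0, 5], [4, 6], [5, 7], [6, 8], [7]]
      ![6, 3, 4, 2, 5, 4, 3, 2, 1]
      ?_ ⟨0, ?_⟩ ?_ ?_ ?_ ?_
    · intro x; fin_cases x <;> simp
    · simp
    · decide
    · intro x; fin_cases x <;> simp [*, h13.symm, h23.symm]
    · intro x; fin_cases x <;> simp [*]
    · intro x; fin_cases x <;> simp <;> norm_num

theorem all_good {A : Type} [Ring A] [Algebra ℂ A] (P : PData G A) (N : Submodule ℂ A)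
    (hN : ∀ x y, x * y - y * x ∈ N) (hNE : ∀ i, P.E i ∈ N) : N = ⊤ := by
  have hac := acyc G hG
  apply P.top_of_good N hN
  intro v
  obtain ⟨c, hcv, hdeg⟩ : ∃ c, G.Reachable c v ∧
      ∀ w, G.Reachable c w → w ≠ c → (G.neighborFinset w).card ≤ 2 := by
    by_cases h : ∃ c, G.Reachable c v ∧ 3 ≤ (G.neighborFinset c).card
    · obtain ⟨c, hc, hc3⟩ := h
      refine ⟨c, hc, fun w hw hne => ?_⟩
      by_contra hcon
      exact unique_branch G hG c w hne.symm hw hc3 (by omega)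
    · push Not at h
      exact ⟨v, SimpleGraph.Reachable.refl v, fun w hw _ => by have := h w hw.symm; omega⟩
  have arm : ∀ u w, G.Reachable c w → G.Adj u w → G.dist c w = G.dist c u + 1 →
      ∃ L, IsArm G u w L ∧ ∀ z ∈ w :: L, G.dist c w ≤ G.dist c z := fun u w h1 h2 h3 =>
    arm_exists G hac c hdeg (Fintype.card K) u w h1 h2 h3 (by omega)
  have harm : ∀ n, G.Adj c n → ∃ L, IsArm G c n L ∧ c ∉ n :: L := by
    intro n hn
    have h1 : G.dist c n = 1 := SimpleGraph.dist_eq_one_iff_adj.2 hn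
    obtain ⟨L, hL, hd⟩ := arm c n hn.reachable hn (by simp [h1])
    refine ⟨L, hL, fun hc => ?_⟩
    have := hd c hc
    simp [h1] at this
  have hc : P.Good N c := by
    have h3 := deg_le G hG c
    rcases (show (G.neighborFinset c).card = 0 ∨ (G.neighborFinset c).card = 1 ∨
      (G.neighborFinset c).card = 2 ∨ (G.neighborFinset c).card = 3 by omega) with h | h | h | h
    · rw [Finset.card_eq_zero] at h
      apply P.center_good0 N hNE
      intro n hn
      have : n ∈ G.neighborFinset c := by simpa using hn
      simp [h] at this
    · obtain ⟨n, hn⟩ := Finset.card_eq_one.1 h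
      apply P.center_good1 N hNE c harm n
      intro w
      rw [← G.mem_neighborFinset, hn]; simp
    · obtain ⟨n, m, hnm, hn⟩ := Finset.card_eq_two.1 h
      apply P.center_good2 N hN hNE c harm n m hnm
      intro w
      rw [← G.mem_neighborFinset, hn]; simp
    · obtain ⟨n₁, n₂, n₃, h12, h13, h23, hn⟩ := Finset.card_eq_three.1 h
      have hadj : ∀ w, G.Adj c w ↔ w = n₁ ∨ w = n₂ ∨ w = n₃ := by
        intro w
        rw [← G.mem_neighborFinset, hn]; simp
      have b₁ : G.Adj c n₁ := (hadj n₁).2 (by simp)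
      have b₂ : G.Adj c n₂ := (hadj n₂).2 (by simp)
      have b₃ : G.Adj c n₃ := (hadj n₃).2 (by simp)
      obtain ⟨L₁, a₁, -⟩ := harm n₁ b₁
      obtain ⟨L₂, a₂, -⟩ := harm n₂ b₂
      obtain ⟨L₃, a₃, -⟩ := harm n₃ b₃
      have e6 := exclE6 G hG h12 h13 h23 b₁ b₂ b₃ a₁ a₂ a₃
      have e7a := exclE7 G hG h12 h13 h23 b₁ b₂ b₃ a₁ a₂
      have e7b := exclE7 G hG h13 h12 h23.symm b₁ b₃ b₂ a₁ a₃
      have e7c := exclE7 G hG h23 h12.symm h13.symm b₂ b₃ b₁ a₂ a₃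
      have e8a := exclE8 G hG h12 h13 h23 b₁ b₂ b₃ a₁ a₂
      have e8b := exclE8 G hG h13 h12 h23.symm b₁ b₃ b₂ a₁ a₃
      have e8c := exclE8 G hG h23 h12.symm h13.symm b₂ b₃ b₁ a₂ a₃
      have e8d := exclE8 G hG h12.symm h23 h13 b₂ b₁ b₃ a₂ a₁
      have e8e := exclE8 G hG h13.symm h23.symm h12 b₃ b₁ b₂ a₃ a₁
      have e8f := exclE8 G hG h23.symm h13.symm h12.symm b₃ b₂ b₁ a₃ a₂
      have := len_arith L₁.length L₂.length L₃.length e6 e7a e7b e7c e8a e8b e8c e8d e8e e8f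
      rcases this with ⟨hl, hl'⟩ | ⟨hl, hl'⟩ | ⟨hl, hl'⟩ | ⟨hl, hl'⟩ | ⟨hl, hl'⟩ | ⟨hl, hl'⟩
      · exact P.center_good3 N hN hNE c harm n₁ n₂ n₃ h12 h13 h23 hadj L₁ L₂ L₃ a₁ a₂ a₃ hl hl'
      · exact P.center_good3 N hN hNE c harm n₁ n₃ n₂ h13 h12 h23.symm
          (fun w => (hadj w).trans or_perm1) L₁ L₃ L₂ a₁ a₃ a₂ hl hl'
      · exact P.center_good3 N hN hNE c harm n₂ n₁ n₃ h12.symm h23 h13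
          (fun w => (hadj w).trans or_perm2) L₂ L₁ L₃ a₂ a₁ a₃ hl hl'
      · exact P.center_good3 N hN hNE c harm n₂ n₃ n₁ h23 h12.symm h13.symm
          (fun w => (hadj w).trans or_perm3) L₂ L₃ L₁ a₂ a₃ a₁ hl hl'
      · exact P.center_good3 N hN hNE c harm n₃ n₁ n₂ h13.symm h23.symm h12
          (fun w => (hadj w).trans or_perm4) L₃ L₁ L₂ a₃ a₁ a₂ hl hl'
      · exact P.center_good3 N hN hNE c harm n₃ n₂ n₁ h23.symm h13.symm h12.symm
          (fun w => (hadj w).trans or_perm5) L₃ L₂ L₁ a₃ a₂ a₁ hl hl'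
  -- propagate along the tree
  have prop : ∀ k, ∀ w, G.Reachable c w → G.dist c w = k → P.Good N w := by
    intro k
    induction k with
    | zero =>
      intro w hw h0
      rw [hw.dist_eq_zero_iff] at h0
      exact h0 ▸ hc
    | succ k ih =>
      intro w hw hk
      obtain ⟨p, hp, hp'⟩ := hw.exists_path_of_dist
      have hnil : ¬ p.Nil := by
        rw [SimpleGraph.Walk.not_nil_iff_lt_length]; omega
      have ha := p.adj_penultimate hnil
      have hr : G.Reachable c p.penultimate := hw.trans ha.symm.reachable
      have hd : G.dist c p.penultimate ≤ k := by
        have := G.dist_le p.dropLast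
        simp at this
        omega
      have hd2 := hac.dist_eq_dist_add_one_of_adj_of_reachable c ha hr
      obtain ⟨L, hL, -⟩ := arm _ w hw ha (by omega)
      exact P.good_arm N hN hNE hL (ih _ hr (by omega))
  exact prop _ v hcv rfl

end Gr2


section Fin6
variable (G : SimpleGraph K) [DecidableRel G.Adj] (ε : Arrow G → ℂ)

/-- images of the generators -/
def mkE (i : K) : Preproj G ε := RingQuot.mkAlgHom ℂ (relR G ε) (eIdem G i)

/-- images of the arrows -/
def mkA (a : Arrow G) : Preproj G ε := RingQuot.mkAlgHom ℂ (relR G ε) (arr G a)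

theorem rel_zero (x : F G) (hx : x ∈ Rels G ε) : RingQuot.mkAlgHom ℂ (relR G ε) x = 0 := by
  have : relR G ε x 0 := ⟨hx, rfl⟩
  rw [RingQuot.mkAlgHom_rel ℂ this, map_zero]

theorem mk_EE (i j : K) : mkE G ε i * mkE G ε j = if i = j then mkE G ε i else 0 := by
  have := rel_zero G ε _ (Or.inl ⟨i, j, rfl⟩)
  rw [map_sub, sub_eq_zero, map_mul] at this
  unfold mkE
  rw [this]; split_ifs <;> simp

theorem mk_E1 : ∑ i, mkE G ε i = 1 := by
  have := rel_zero G ε _ (Or.inr (Or.inl rfl))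
  rw [map_sub, sub_eq_zero, map_one, map_sum] at this
  exact this.symm

theorem mk_EA (a : Arrow G) : mkE G ε (tgt a) * mkA G ε a = mkA G ε a := by
  have := rel_zero G ε _ (Or.inr (Or.inr (Or.inl ⟨a, rfl⟩)))
  rw [map_sub, sub_eq_zero, map_mul] at this
  exact this

theorem mk_AE (a : Arrow G) : mkA G ε a * mkE G ε (src a) = mkA G ε a := by
  have := rel_zero G ε _ (Or.inr (Or.inr (Or.inr (Or.inl ⟨a, rfl⟩))))
  rw [map_sub, sub_eq_zero, map_mul] at this
  exact this

/-- total arrow function -/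
def mkR (i j : K) : Preproj G ε := if h : G.Adj i j then mkA G ε ⟨(i, j), h⟩ else 0

/-- total sign function -/
def mkS (i j : K) : ℂ := if h : G.Adj i j then ε ⟨(i, j), h⟩ else 0

theorem mk_rel (i : K) : ∑ j, mkS G ε j i • (mkR G ε j i * mkR G ε i j) = 0 := by
  have := rel_zero G ε _ (Or.inr (Or.inr (Or.inr (Or.inr ⟨i, rfl⟩))))
  rw [map_sum] at this
  rw [← this]
  apply Finset.sum_congr rfl
  intro j _
  by_cases h : G.Adj j i
  · simp only [mkS, mkR, h, h.symm, dif_pos, map_smul, map_mul, mkA]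
  · simp [mkS, h]

theorem mk_gen (M : Submodule ℂ (Preproj G ε)) (h1 : 1 ∈ M)
    (hE : ∀ i, ∀ x ∈ M, mkE G ε i * x ∈ M) (hR : ∀ i j, ∀ x ∈ M, mkR G ε i j * x ∈ M) :
    M = ⊤ := by
  have key : ∀ w : F G, ∀ x ∈ M, RingQuot.mkAlgHom ℂ (relR G ε) w * x ∈ M := by
    intro w
    induction w using FreeAlgebra.induction with
    | grade0 r =>
      intro x hx
      rw [AlgHom.commutes, ← Algebra.smul_def]
      exact M.smul_mem _ hx
    | grade1 g =>
      intro x hx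
      rcases g with i | a
      · exact hE i x hx
      · have := hR a.1.1 a.1.2 x hx
        simp only [mkR, a.2, dif_pos] at this
        exact this
    | mul a b ha hb =>
      intro x hx
      rw [map_mul, mul_assoc]
      exact ha _ (hb _ hx)
    | add a b ha hb =>
      intro x hx
      rw [map_add, add_mul]
      exact M.add_mem (ha _ hx) (hb _ hx)
  rw [eq_top_iff]
  intro y _
  obtain ⟨w, rfl⟩ := RingQuot.mkAlgHom_surjective ℂ (relR G ε) y
  simpa using key w 1 h1

/-- the preprojective data -/
def mkP (hε1 : ∀ a : Arrow G, ε a = 1 ∨ ε a = -1) : PData G (Preproj G ε) where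
  E := mkE G ε
  R := mkR G ε
  s := mkS G ε
  hEE := mk_EE G ε
  hE1 := mk_E1 G ε
  hER := fun i j => by
    unfold mkR
    split_ifs with h
    · exact mk_EA G ε ⟨(i, j), h⟩
    · simp
  hRE := fun i j => by
    unfold mkR
    split_ifs with h
    · exact mk_AE G ε ⟨(i, j), h⟩
    · simp
  hR0 := fun i j h => by simp [mkR, h]
  hs := fun i j h => by
    simp only [mkS, h, dif_pos]
    rcases hε1 ⟨(i, j), h⟩ with h' | h' <;> rw [h'] <;> simp
  hrel := mk_rel G ε
  hgen := mk_gen G ε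

/-- generators to the diagonal algebra -/
def dg : Gen G → (K → ℂ)
  | Sum.inl i => Pi.single i 1
  | Sum.inr _ => 0

theorem dg_e (i : K) : FreeAlgebra.lift ℂ (dg G) (eIdem G i) = Pi.single i 1 := by
  exact FreeAlgebra.lift_ι_apply (dg G) (Sum.inl i : Gen G)

theorem dg_a (a : Arrow G) : FreeAlgebra.lift ℂ (dg G) (arr G a) = 0 := by
  exact FreeAlgebra.lift_ι_apply (dg G) (Sum.inr a : Gen G)

theorem dg_rel (x y : F G) (h : relR G ε x y) :
    FreeAlgebra.lift ℂ (dg G) x = FreeAlgebra.lift ℂ (dg G) y := by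
  obtain ⟨h, rfl⟩ := h
  rw [map_zero]
  rcases h with ⟨i, j, rfl⟩ | rfl | ⟨a, rfl⟩ | ⟨a, rfl⟩ | ⟨i, rfl⟩
  · rw [map_sub, map_mul, dg_e, dg_e]
    split_ifs with h
    · subst h
      rw [dg_e]
      ext k
      by_cases hk : k = i
      · subst hk; simp
      · simp [hk]
    · rw [map_zero, sub_zero]
      ext k
      by_cases hk : k = i
      · subst hk; simp [h]
      · simp [hk]
  · rw [map_sub, map_one, map_sum]
    simp only [dg_e]
    ext k
    simp [Finset.sum_apply, Pi.single_apply]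
  · rw [map_sub, map_mul, dg_a]; simp
  · rw [map_sub, map_mul, dg_a]; simp
  · rw [map_sum]
    apply Finset.sum_eq_zero
    intro j _
    split_ifs with h
    · have e1 := dg_a G (⟨(j, i), h⟩ : Arrow G)
      rw [map_smul, map_mul]
      exact (congrArg (fun t => ε ⟨(j, i), h⟩ • (t *
        FreeAlgebra.lift ℂ (dg G) (arr G ⟨(i, j), h.symm⟩))) e1).trans (by simp)
    · simp

/-- the diagonal quotient -/
def diagHom : Preproj G ε →ₐ[ℂ] (K → ℂ) :=
  RingQuot.liftAlgHom ℂ ⟨FreeAlgebra.lift ℂ (dg G), fun {x y} h => dg_rel G ε x y h⟩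

theorem diagHom_E (i : K) : diagHom G ε (mkE G ε i) = Pi.single i 1 := by
  unfold diagHom mkE
  rw [RingQuot.liftAlgHom_mkAlgHom_apply, dg_e]

end Fin6

/-- **Malkin–Ostrik–Vybornov.** For the preprojective algebra `Π` of a
(possibly disconnected) finite-type ADE Dynkin diagram, `Π` is the internal direct sum of
the span `C` of all commutators and the span of the vertex idempotents `e_i`. -/
theorem stmt3 (G : SimpleGraph K) [DecidableRel G.Adj]
    (hG : ((2 : ℝ) • (1 : Matrix K K ℝ) - G.adjMatrix ℝ).PosDef)
    (ε : Arrow G → ℂ)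
    (hε1 : ∀ a : Arrow G, ε a = 1 ∨ ε a = -1)
    (hε2 : ∀ a : Arrow G, ε (star a) = - ε a) :
    (Submodule.span ℂ {z : Preproj G ε | ∃ x y : Preproj G ε, z = x * y - y * x} ⊔
        Submodule.span ℂ
          (Set.range fun i : K => RingQuot.mkAlgHom ℂ (relR G ε) (eIdem G i)) = ⊤) ∧
    (Submodule.span ℂ {z : Preproj G ε | ∃ x y : Preproj G ε, z = x * y - y * x} ⊓
        Submodule.span ℂ
          (Set.range fun i : K => RingQuot.mkAlgHom ℂ (relR G ε) (eIdem G i)) = ⊥) := by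
  constructor
  · apply all_good G hG (mkP G ε hε1)
    · intro x y
      exact Submodule.mem_sup_left (Submodule.subset_span ⟨x, y, rfl⟩)
    · intro i
      exact Submodule.mem_sup_right (Submodule.subset_span ⟨i, rfl⟩)
  · rw [eq_bot_iff]
    rintro z ⟨hz1, hz2⟩
    have hC : diagHom G ε z = 0 := by
      have hle : Submodule.span ℂ {z : Preproj G ε | ∃ x y : Preproj G ε, z = x * y - y * x} ≤
          LinearMap.ker (diagHom G ε).toLinearMap := by
        rw [Submodule.span_le]
        rintro _ ⟨x, y, rfl⟩
        simp [mul_comm]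
      have := hle hz1
      simpa using this
    obtain ⟨t, ht⟩ := (Submodule.mem_span_range_iff_exists_fun ℂ).1 hz2
    have ht' : ∑ i, t i • mkE G ε i = z := ht
    have h0 : ∀ i, t i = 0 := by
      intro i
      rw [← ht', map_sum] at hC
      simp only [map_smul, diagHom_E] at hC
      have := congrFun hC i
      simpa [Finset.sum_apply, Pi.single_apply] using this
    rw [Submodule.mem_bot, ← ht']
    simp [h0]

end Stmt3
end
end
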